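/- Under the mean curvature flow in R^n, the squared norm of the second fundamental form satisfies d/dt |A|² = Δ|A|² − 2|∇^⊥A|² + 2|A^{αm}_n A^{βn}_m|² + 2|R^{αβ}_{ij}|², where R^{αβ}_{ij} is the normal curvature tensor. -/

import Mathlib

noncomputable section

open Real Finset

/-- Partial derivative of a scalar function on `ℝ^m` in direction `i`. -/
def pd {m : ℕ} (f : (Fin m → ℝ) → ℝ) (i : Fin m) (x : Fin m → ℝ) : ℝ :=
  fderiv ℝ f x (Pi.single i 1)

/-- Components `F^α_i` of the differential of an immersion `F : ℝ^m → ℝ^n`. -/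
def Fd {m n : ℕ} (F : (Fin m → ℝ) → (Fin n → ℝ)) (α : Fin n) (i : Fin m)
    (x : Fin m → ℝ) : ℝ :=
  pd (fun y => F y α) i x

/-- Induced metric `g_{ij} = ⟨F_i, F_j⟩`. -/
def gInd {m n : ℕ} (F : (Fin m → ℝ) → (Fin n → ℝ)) (i j : Fin m) (x : Fin m → ℝ) : ℝ :=
  ∑ α, Fd F α i x * Fd F α j x

/-- Induced metric as a matrix. -/
def gMat {m n : ℕ} (F : (Fin m → ℝ) → (Fin n → ℝ)) (x : Fin m → ℝ) :
    Matrix (Fin m) (Fin m) ℝ :=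
  fun i j => gInd F i j x

/-- Inverse metric `g^{ij}`. -/
def gInv {m n : ℕ} (F : (Fin m → ℝ) → (Fin n → ℝ)) (i j : Fin m) (x : Fin m → ℝ) : ℝ :=
  (gMat F x)⁻¹ i j

/-- Christoffel symbols `Γ^k_{ij}` of the induced metric. -/
def chr {m n : ℕ} (F : (Fin m → ℝ) → (Fin n → ℝ)) (k i j : Fin m) (x : Fin m → ℝ) : ℝ :=
  (1/2) * ∑ l, gInv F k l x *
    (pd (gInd F l j) i x + pd (gInd F l i) j x - pd (gInd F i j) l x)

/-- Second fundamental form `A^α_{ij} = F^α_{ij} - Γ^k_{ij} F^α_k`. -/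
def sff {m n : ℕ} (F : (Fin m → ℝ) → (Fin n → ℝ)) (α : Fin n) (i j : Fin m)
    (x : Fin m → ℝ) : ℝ :=
  pd (fun y => Fd F α j y) i x - ∑ k, chr F k i j x * Fd F α k x

/-- Mean curvature vector `H^α = g^{ij} A^α_{ij}`. -/
def mcv {m n : ℕ} (F : (Fin m → ℝ) → (Fin n → ℝ)) (α : Fin n) (x : Fin m → ℝ) : ℝ :=
  ∑ i, ∑ j, gInv F i j x * sff F α i j x

/-- Riemann curvature tensor `R^l_{kij}` of the induced metric. -/
def riem {m n : ℕ} (F : (Fin m → ℝ) → (Fin n → ℝ)) (l k i j : Fin m) (x : Fin m → ℝ) : ℝ :=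
  pd (fun y => chr F l j k y) i x - pd (fun y => chr F l i k y) j x
    + ∑ p, (chr F l i p x * chr F p j k x - chr F l j p x * chr F p i k x)

/-- Riemann curvature tensor with all indices lowered, `R_{ijkl} = g_{ip} R^p_{jkl}`. -/
def riemLow {m n : ℕ} (F : (Fin m → ℝ) → (Fin n → ℝ)) (i j k l : Fin m) (x : Fin m → ℝ) : ℝ :=
  ∑ p, gInd F i p x * riem F p j k l x

/-- Ricci curvature `R_{ij} = R^k_{ikj}` of the induced metric. -/
def ricci {m n : ℕ} (F : (Fin m → ℝ) → (Fin n → ℝ)) (i j : Fin m) (x : Fin m → ℝ) : ℝ :=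
  ∑ k, riem F k i k j x

/-- Tangential projector `T^α_β = g^{ij} F^α_i F^β_j` onto the tangent space. -/
def tanP {m n : ℕ} (F : (Fin m → ℝ) → (Fin n → ℝ)) (α β : Fin n) (x : Fin m → ℝ) : ℝ :=
  ∑ i, ∑ j, gInv F i j x * Fd F α i x * Fd F β j x

/-- Normal projector `N = id - T` onto the normal bundle. -/
def norP {m n : ℕ} (F : (Fin m → ℝ) → (Fin n → ℝ)) (α β : Fin n) (x : Fin m → ℝ) : ℝ :=
  (if α = β then 1 else 0) - tanP F α β x

/-- Derivative of the normal projector. -/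
def dnorP {m n : ℕ} (F : (Fin m → ℝ) → (Fin n → ℝ)) (i : Fin m) (α β : Fin n)
    (x : Fin m → ℝ) : ℝ :=
  pd (fun y => norP F α β y) i x

/-- Curvature `R^{αβ}_{ij}` of the normal connection (the connection `N ∘ d` on the
normal bundle `im N`), given by the standard formula `N (∂_i N ∂_j N - ∂_j N ∂_i N) N`. -/
def normCurv {m n : ℕ} (F : (Fin m → ℝ) → (Fin n → ℝ)) (α β : Fin n) (i j : Fin m)
    (x : Fin m → ℝ) : ℝ :=
  ∑ γ, ∑ δ, ∑ ε,
    norP F α γ x * (dnorP F i γ δ x * dnorP F j δ ε x - dnorP F j γ δ x * dnorP F i δ ε x)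
      * norP F ε β x

/-- Covariant derivative `∇_l A^α_{ij}` of the second fundamental form, using the full
induced connection (the pullback connection on `F⁻¹Tℝⁿ` is flat in cartesian coordinates). -/
def covA {m n : ℕ} (F : (Fin m → ℝ) → (Fin n → ℝ)) (l : Fin m) (α : Fin n) (i j : Fin m)
    (x : Fin m → ℝ) : ℝ :=
  pd (fun y => sff F α i j y) l x - ∑ k, chr F k l i x * sff F α k j x
    - ∑ k, chr F k l j x * sff F α i k x

/-- Second covariant derivative `∇_p ∇_l A^α_{ij}`. -/
def cov2A {m n : ℕ} (F : (Fin m → ℝ) → (Fin n → ℝ)) (p l : Fin m) (α : Fin n) (i j : Fin m)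
    (x : Fin m → ℝ) : ℝ :=
  pd (fun y => covA F l α i j y) p x - ∑ k, chr F k p l x * covA F k α i j x
    - ∑ k, chr F k p i x * covA F l α k j x - ∑ k, chr F k p j x * covA F l α i k x

/-- Covariant Hessian `∇_l ∇_k H^α` of the mean curvature vector. -/
def hessH {m n : ℕ} (F : (Fin m → ℝ) → (Fin n → ℝ)) (α : Fin n) (l k : Fin m)
    (x : Fin m → ℝ) : ℝ :=
  pd (fun y => pd (fun z => mcv F α z) k y) l x - ∑ p, chr F p l k x * pd (fun z => mcv F α z) p x

/-- Covariant derivative `∇_l R_{ij}` of the Ricci tensor. -/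
def covRic {m n : ℕ} (F : (Fin m → ℝ) → (Fin n → ℝ)) (l i j : Fin m) (x : Fin m → ℝ) : ℝ :=
  pd (fun y => ricci F i j y) l x - ∑ p, chr F p l i x * ricci F p j x
    - ∑ p, chr F p l j x * ricci F i p x

/-- The tensor `a_{ij} = g_{αβ} H^α A^β_{ij}`. -/
def aT {m n : ℕ} (F : (Fin m → ℝ) → (Fin n → ℝ)) (i j : Fin m) (x : Fin m → ℝ) : ℝ :=
  ∑ α, mcv F α x * sff F α i j x

/-- The tensor `b_{ij} = g_{αβ} A^α_{ik} A^{βk}_j`. -/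
def bT {m n : ℕ} (F : (Fin m → ℝ) → (Fin n → ℝ)) (i j : Fin m) (x : Fin m → ℝ) : ℝ :=
  ∑ α, ∑ k, ∑ l, gInv F k l x * sff F α i k x * sff F α j l x

/-- Squared norm `|H|²` of the mean curvature vector. -/
def normH2 {m n : ℕ} (F : (Fin m → ℝ) → (Fin n → ℝ)) (x : Fin m → ℝ) : ℝ :=
  ∑ α, (mcv F α x) ^ 2

/-- Squared norm `|A|²` of the second fundamental form. -/
def normA2 {m n : ℕ} (F : (Fin m → ℝ) → (Fin n → ℝ)) (x : Fin m → ℝ) : ℝ :=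
  ∑ α, ∑ i, ∑ j, ∑ k, ∑ l,
    gInv F i k x * gInv F j l x * sff F α i j x * sff F α k l x

/-- Squared norm `|a_{ij}|²`. -/
def normaT2 {m n : ℕ} (F : (Fin m → ℝ) → (Fin n → ℝ)) (x : Fin m → ℝ) : ℝ :=
  ∑ i, ∑ j, ∑ k, ∑ l, gInv F i k x * gInv F j l x * aT F i j x * aT F k l x

/-- Components `∇_i H^α + a_i^l F^α_l` of the normal covariant derivative of `H`. -/
def nperpH {m n : ℕ} (F : (Fin m → ℝ) → (Fin n → ℝ)) (i : Fin m) (α : Fin n)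
    (x : Fin m → ℝ) : ℝ :=
  pd (fun y => mcv F α y) i x + ∑ l, ∑ k, gInv F l k x * aT F i k x * Fd F α l x

/-- Squared norm `|∇^⊥ H|²`. -/
def normNperpH2 {m n : ℕ} (F : (Fin m → ℝ) → (Fin n → ℝ)) (x : Fin m → ℝ) : ℝ :=
  ∑ α, ∑ i, ∑ j, gInv F i j x * nperpH F i α x * nperpH F j α x

/-- Components `∇_l A^α_{ij} + A^β_{ij} A^k_{βl} F^α_k` of the normal covariant
derivative of `A`. -/
def nperpA {m n : ℕ} (F : (Fin m → ℝ) → (Fin n → ℝ)) (l : Fin m) (α : Fin n) (i j : Fin m)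
    (x : Fin m → ℝ) : ℝ :=
  covA F l α i j x + ∑ β, ∑ k, ∑ p, sff F β i j x * gInv F k p x * sff F β p l x * Fd F α k x

/-- Squared norm `|∇^⊥ A|²`. -/
def normNperpA2 {m n : ℕ} (F : (Fin m → ℝ) → (Fin n → ℝ)) (x : Fin m → ℝ) : ℝ :=
  ∑ α, ∑ l, ∑ l', ∑ i, ∑ i', ∑ j, ∑ j',
    gInv F l l' x * gInv F i i' x * gInv F j j' x * nperpA F l α i j x * nperpA F l' α i' j' x

/-- The symmetric bilinear form `S^{αβ} = A^{αm}_n A^{βn}_m` on the normal bundle. -/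
def ssf {m n : ℕ} (F : (Fin m → ℝ) → (Fin n → ℝ)) (α β : Fin n) (x : Fin m → ℝ) : ℝ :=
  ∑ i, ∑ j, (∑ k, gInv F i k x * sff F α k j x) * (∑ p, gInv F j p x * sff F β p i x)

/-- Squared norm `|A^{αm}_n A^{βn}_m|²`. -/
def normSsf2 {m n : ℕ} (F : (Fin m → ℝ) → (Fin n → ℝ)) (x : Fin m → ℝ) : ℝ :=
  ∑ α, ∑ β, (ssf F α β x) ^ 2

/-- Squared norm `|R^⊥|²` of the normal curvature. -/
def normRperp2 {m n : ℕ} (F : (Fin m → ℝ) → (Fin n → ℝ)) (x : Fin m → ℝ) : ℝ :=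
  ∑ α, ∑ β, ∑ i, ∑ j, ∑ k, ∑ l,
    gInv F i k x * gInv F j l x * normCurv F α β i j x * normCurv F α β k l x

/-- Riemannian volume density `√(det g)`. -/
def volDens {m n : ℕ} (F : (Fin m → ℝ) → (Fin n → ℝ)) (x : Fin m → ℝ) : ℝ :=
  Real.sqrt (gMat F x).det

/-- Laplace–Beltrami operator on scalar functions, `Δf = g^{ij}(∂_i∂_j f - Γ^k_{ij} ∂_k f)`. -/
def lapBel {m n : ℕ} (F : (Fin m → ℝ) → (Fin n → ℝ)) (f : (Fin m → ℝ) → ℝ)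
    (x : Fin m → ℝ) : ℝ :=
  ∑ i, ∑ j, gInv F i j x * (pd (fun y => pd f i y) j x - ∑ k, chr F k i j x * pd f k x)

open scoped Topology ContDiff

section Calculus

variable {m : ℕ} {f g : (Fin m → ℝ) → ℝ} {x : Fin m → ℝ}

theorem pd_congr (h : f =ᶠ[𝓝 x] g) (i : Fin m) : pd f i x = pd g i x := by
  simp [pd, h.fderiv_eq]

theorem Filter.EventuallyEq.pd (h : f =ᶠ[𝓝 x] g) (i : Fin m) : pd f i =ᶠ[𝓝 x] pd g i :=
  h.eventuallyEq_nhds.mono fun _ hy => pd_congr hy i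

theorem pd_const (c : ℝ) (i : Fin m) : pd (fun _ => c) i x = 0 := by
  simp [pd]

theorem pd_coord (i j : Fin m) : pd (fun y => y i) j x = if i = j then 1 else 0 := by
  have : (fun y : Fin m → ℝ => y i) = ContinuousLinearMap.proj (R := ℝ) (φ := fun _ => ℝ) i := rfl
  rw [pd, this, ContinuousLinearMap.fderiv]
  simp [Pi.single_apply]

theorem pd_add (hf : DifferentiableAt ℝ f x) (hg : DifferentiableAt ℝ g x) (i : Fin m) :
    pd (fun y => f y + g y) i x = pd f i x + pd g i x := by
  simp [pd, fderiv_fun_add hf hg]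

theorem pd_sub (hf : DifferentiableAt ℝ f x) (hg : DifferentiableAt ℝ g x) (i : Fin m) :
    pd (fun y => f y - g y) i x = pd f i x - pd g i x := by
  simp [pd, fderiv_fun_sub hf hg]

theorem pd_mul (hf : DifferentiableAt ℝ f x) (hg : DifferentiableAt ℝ g x) (i : Fin m) :
    pd (fun y => f y * g y) i x = pd f i x * g x + f x * pd g i x := by
  simp [pd, fderiv_fun_mul hf hg]
  ring

theorem pd_const_mul (c : ℝ) (hf : DifferentiableAt ℝ f x) (i : Fin m) :
    pd (fun y => c * f y) i x = c * pd f i x := by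
  simp [pd, fderiv_const_mul hf]

theorem pd_sum {ι : Type*} {s : Finset ι} {h : ι → (Fin m → ℝ) → ℝ}
    (hh : ∀ a ∈ s, DifferentiableAt ℝ (h a) x) (i : Fin m) :
    pd (fun y => ∑ a ∈ s, h a y) i x = ∑ a ∈ s, pd (h a) i x := by
  simp [pd, fderiv_fun_sum hh]

theorem ContDiffAt.pd {k l : WithTop ℕ∞} (hf : ContDiffAt ℝ l f x) (hkl : k + 1 ≤ l) (i : Fin m) :
    ContDiffAt ℝ k (pd f i) x :=
  (hf.fderiv_right hkl).clm_apply contDiffAt_const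

theorem ContDiffAt.pd_infty (hf : ContDiffAt ℝ ∞ f x) (i : Fin m) :
    ContDiffAt ℝ ∞ (_root_.pd f i) x :=
  hf.pd (by simp) i

theorem ContDiffAt.diff_of_infty {E F : Type*} [NormedAddCommGroup E] [NormedSpace ℝ E]
    [NormedAddCommGroup F] [NormedSpace ℝ F] {f : E → F} {x : E}
    (hf : ContDiffAt ℝ ∞ f x) : DifferentiableAt ℝ f x :=
  hf.differentiableAt (by simp)

theorem ContDiffAt.eventually_of_infty {E F : Type*} [NormedAddCommGroup E] [NormedSpace ℝ E]
    [NormedAddCommGroup F] [NormedSpace ℝ F] {f : E → F} {x : E}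
    (hf : ContDiffAt ℝ ∞ f x) (k : ℕ) : ∀ᶠ y in 𝓝 x, ContDiffAt ℝ k f y :=
  (hf.of_le (by exact_mod_cast le_top)).eventually (by simp)

theorem ContDiffAt.eventually_diff {E F : Type*} [NormedAddCommGroup E] [NormedSpace ℝ E]
    [NormedAddCommGroup F] [NormedSpace ℝ F] {f : E → F} {x : E}
    (hf : ContDiffAt ℝ ∞ f x) : ∀ᶠ y in 𝓝 x, DifferentiableAt ℝ f y :=
  (hf.eventually_of_infty 1).mono fun _ hy => hy.differentiableAt (by simp)

theorem pd_comm (hf : ContDiffAt ℝ 2 f x) (i j : Fin m) :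
    pd (pd f i) j x = pd (pd f j) i x := by
  have hd : DifferentiableAt ℝ (fderiv ℝ f) x :=
    (hf.fderiv_right (m := 1) (by norm_num)).differentiableAt (by simp)
  have key : ∀ a b : Fin m, pd (pd f a) b x
      = fderiv ℝ (fderiv ℝ f) x (Pi.single b 1) (Pi.single a 1) := by
    intro a b
    show fderiv ℝ (fun y => fderiv ℝ f y (Pi.single a 1)) x (Pi.single b 1) = _
    rw [fderiv_clm_apply hd (by fun_prop)]
    simp
  rw [key, key]
  exact (hf.isSymmSndFDerivAt (by simp)).eq _ _

theorem pd_pd_sub (hf : ContDiffAt ℝ ∞ f x) (hg : ContDiffAt ℝ ∞ g x) (i j : Fin m) :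
    pd (pd (fun y => f y - g y) i) j x = pd (pd f i) j x - pd (pd g i) j x := by
  have : pd (fun y => f y - g y) i =ᶠ[𝓝 x] fun y => pd f i y - pd g i y := by
    filter_upwards [hf.eventually_diff, hg.eventually_diff] with y h1 h2 using pd_sub h1 h2 i
  rw [pd_congr this, pd_sub (hf.pd_infty i).diff_of_infty (hg.pd_infty i).diff_of_infty]

theorem pd_pd_mul (hf : ContDiffAt ℝ ∞ f x) (hg : ContDiffAt ℝ ∞ g x) (i j : Fin m) :
    pd (pd (fun y => f y * g y) i) j x = pd (pd f i) j x * g x + pd f i x * pd g j x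
      + pd f j x * pd g i x + f x * pd (pd g i) j x := by
  have : pd (fun y => f y * g y) i =ᶠ[𝓝 x] fun y => pd f i y * g y + f y * pd g i y := by
    filter_upwards [hf.eventually_diff, hg.eventually_diff] with y h1 h2 using pd_mul h1 h2 i
  have hfi := (hf.pd_infty i).diff_of_infty
  have hgi := (hg.pd_infty i).diff_of_infty
  have hf' := hf.diff_of_infty
  have hg' := hg.diff_of_infty
  rw [pd_congr this, pd_add (hfi.fun_mul hg') (hf'.fun_mul hgi), pd_mul hfi hg', pd_mul hf' hgi]
  ring

theorem pd_pd_sum {ι : Type*} {s : Finset ι} {h : ι → (Fin m → ℝ) → ℝ}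
    (hh : ∀ a ∈ s, ContDiffAt ℝ ∞ (h a) x) (i j : Fin m) :
    pd (pd (fun y => ∑ a ∈ s, h a y) i) j x = ∑ a ∈ s, pd (pd (h a) i) j x := by
  have : pd (fun y => ∑ a ∈ s, h a y) i =ᶠ[𝓝 x] fun y => ∑ a ∈ s, pd (h a) i y := by
    have : ∀ᶠ y in 𝓝 x, ∀ a ∈ s, DifferentiableAt ℝ (h a) y :=
      (s.eventually_all).2 fun a ha => (hh a ha).eventually_diff
    filter_upwards [this] with y h1 using pd_sum h1 i
  rw [pd_congr this, pd_sum fun a ha => ((hh a ha).pd_infty i).diff_of_infty]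

/-- Chain rule for `pd`. -/
theorem pd_comp {p : ℕ} {φ : (Fin p → ℝ) → (Fin m → ℝ)} {y : Fin p → ℝ}
    (hf : DifferentiableAt ℝ f (φ y)) (hφ : DifferentiableAt ℝ φ y) (i : Fin p) :
    pd (fun z => f (φ z)) i y = ∑ a, pd f a (φ y) * pd (fun z => φ z a) i y := by
  have h1 : fderiv ℝ (fun z => f (φ z)) y = (fderiv ℝ f (φ y)).comp (fderiv ℝ φ y) :=
    fderiv_comp y hf hφ
  have h2 : ∀ a, pd (fun z => φ z a) i y = fderiv ℝ φ y (Pi.single i 1) a := by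
    intro a
    rw [pd, fderiv_apply hφ]
    rfl
  rw [pd, h1, ContinuousLinearMap.comp_apply]
  conv_lhs => rw [pi_eq_sum_univ' (fderiv ℝ φ y (Pi.single i 1))]
  rw [map_sum]
  refine sum_congr rfl fun a _ => ?_
  rw [map_smul, h2, smul_eq_mul, mul_comm, pd]

end Calculus

section Smoothness

variable {E : Type*} [NormedAddCommGroup E] [NormedSpace ℝ E]

theorem contDiffAt_matrix_inv {m : ℕ} {k : WithTop ℕ∞} {M : E → Matrix (Fin m) (Fin m) ℝ} {p : E}
    (hM : ∀ i j, ContDiffAt ℝ k (fun q => M q i j) p) (hdet : (M p).det ≠ 0) (i j : Fin m) :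
    ContDiffAt ℝ k (fun q => (M q)⁻¹ i j) p := by
  have hd : ∀ N : E → Matrix (Fin m) (Fin m) ℝ, (∀ i j, ContDiffAt ℝ k (fun q => N q i j) p) →
      ContDiffAt ℝ k (fun q => (N q).det) p := by
    intro N hN
    simp only [Matrix.det_apply]
    exact ContDiffAt.sum fun σ _ => (contDiffAt_prod fun a _ => hN _ _).const_smul _
  simp only [Matrix.inv_def, Matrix.smul_apply, smul_eq_mul, Ring.inverse_eq_inv',
    Matrix.adjugate_apply]
  refine ((hd M hM).inv hdet).mul (hd _ fun a b => ?_)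
  by_cases h : a = j
  · subst h
    simp only [Matrix.updateRow_self]
    exact contDiffAt_const
  · simp only [Matrix.updateRow_ne h]
    exact hM _ _

end Smoothness

/-- Second partial derivatives `F^α_{ij}` of an immersion. -/
def Fdd {m n : ℕ} (F : (Fin m → ℝ) → (Fin n → ℝ)) (α : Fin n) (i j : Fin m)
    (x : Fin m → ℝ) : ℝ :=
  pd (Fd F α j) i x

section Pointwise

variable {m n : ℕ} {f : (Fin m → ℝ) → (Fin n → ℝ)} {x : Fin m → ℝ}

theorem ContDiffAt.Fd {k l : WithTop ℕ∞} (hf : ContDiffAt ℝ l f x) (hkl : k + 1 ≤ l)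
    (α : Fin n) (i : Fin m) : ContDiffAt ℝ k (_root_.Fd f α i) x :=
  (contDiffAt_pi.1 hf α).pd hkl i

theorem ContDiffAt.Fdd {k l : WithTop ℕ∞} (hf : ContDiffAt ℝ l f x) (hkl : k + 1 + 1 ≤ l)
    (α : Fin n) (i j : Fin m) : ContDiffAt ℝ k (_root_.Fdd f α i j) x :=
  (hf.Fd hkl α j).pd le_rfl i

theorem Fdd_symm (hf : ContDiffAt ℝ 2 f x) (α : Fin n) (i j : Fin m) :
    Fdd f α i j x = Fdd f α j i x :=
  pd_comm (contDiffAt_pi.1 hf α) j i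

theorem gInd_symm (i j : Fin m) : gInd f i j x = gInd f j i x :=
  sum_congr rfl fun _ _ => mul_comm _ _

theorem gInv_symm (i j : Fin m) : gInv f i j x = gInv f j i x := by
  have h : (gMat f x).transpose = gMat f x := by
    ext i j
    exact gInd_symm j i
  have := congrFun (congrFun (Matrix.transpose_nonsing_inv (gMat f x)) i) j
  rw [h, Matrix.transpose_apply] at this
  exact this.symm

theorem gInv_mul_gInd (hdet : (gMat f x).det ≠ 0) (i j : Fin m) :
    ∑ k, gInv f i k x * gInd f k j x = if i = j then 1 else 0 := by
  have h := Matrix.nonsing_inv_mul (gMat f x) (isUnit_iff_ne_zero.2 hdet)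
  have := congrFun (congrFun h i) j
  rw [Matrix.mul_apply, Matrix.one_apply] at this
  exact this

theorem pd_gInd (hf : ContDiffAt ℝ 2 f x) (i j k : Fin m) :
    pd (gInd f i j) k x = ∑ α, (Fdd f α k i x * Fd f α j x + Fd f α i x * Fdd f α k j x) := by
  have hd : ∀ α i, DifferentiableAt ℝ (Fd f α i) x := fun α i =>
    (hf.Fd (k := 1) (by norm_num) α i).differentiableAt (by simp)
  show pd (fun y => ∑ α, Fd f α i y * Fd f α j y) k x = _
  rw [pd_sum fun α _ => (hd α i).fun_mul (hd α j)]
  exact sum_congr rfl fun α _ => pd_mul (hd α i) (hd α j) k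

theorem chr_eq (hf : ContDiffAt ℝ 2 f x) (k i j : Fin m) :
    chr f k i j x = ∑ l, gInv f k l x * ∑ α, Fdd f α i j x * Fd f α l x := by
  rw [chr, mul_sum]
  refine sum_congr rfl fun l _ => ?_
  rw [pd_gInd hf, pd_gInd hf, pd_gInd hf, ← sum_add_distrib, ← sum_sub_distrib, mul_sum, mul_sum,
    mul_sum]
  refine sum_congr rfl fun α _ => ?_
  rw [Fdd_symm hf α j i, Fdd_symm hf α l i, Fdd_symm hf α l j]
  ring

theorem sff_eq (α : Fin n) (i j : Fin m) :
    sff f α i j x = Fdd f α i j x - ∑ k, chr f k i j x * Fd f α k x :=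
  rfl

theorem chr_symm (hf : ContDiffAt ℝ 2 f x) (k i j : Fin m) : chr f k i j x = chr f k j i x := by
  simp only [chr_eq hf, Fdd_symm hf _ i j]

theorem sff_symm (hf : ContDiffAt ℝ 2 f x) (α : Fin n) (i j : Fin m) :
    sff f α i j x = sff f α j i x := by
  simp only [sff_eq, Fdd_symm hf _ i j, chr_symm hf _ i j]

theorem sff_eq_norP (hf : ContDiffAt ℝ 2 f x) (α : Fin n) (i j : Fin m) :
    sff f α i j x = ∑ β, norP f α β x * Fdd f β i j x := by
  simp only [sff_eq, norP, sub_mul, sum_sub_distrib, ite_mul, one_mul, zero_mul, sum_ite_eq,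
    mem_univ, if_true, chr_eq hf, tanP, sum_mul, mul_sum]
  congr 1
  rw [sum_comm' (s := univ) (t := fun _ => univ) (t' := univ) (s' := fun _ => univ) (by simp)]
  refine Eq.trans ?_ (Eq.symm sum_comm)
  rw [sum_comm]
  refine sum_congr rfl fun k _ => ?_
  rw [sum_comm]
  refine sum_congr rfl fun l _ => sum_congr rfl fun β _ => ?_
  ring

theorem contDiffAt_gInd (hf : ContDiffAt ℝ ∞ f x) (i j : Fin m) : ContDiffAt ℝ ∞ (gInd f i j) x :=
  ContDiffAt.sum fun α _ => (hf.Fd (by simp) α i).mul (hf.Fd (by simp) α j)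

theorem contDiffAt_gInv (hf : ContDiffAt ℝ ∞ f x) (hdet : (gMat f x).det ≠ 0) (i j : Fin m) :
    ContDiffAt ℝ ∞ (gInv f i j) x :=
  contDiffAt_matrix_inv (contDiffAt_gInd hf) hdet i j

theorem contDiffAt_chr (hf : ContDiffAt ℝ ∞ f x) (hdet : (gMat f x).det ≠ 0) (k i j : Fin m) :
    ContDiffAt ℝ ∞ (chr f k i j) x :=
  contDiffAt_const.mul <| ContDiffAt.sum fun l _ => (contDiffAt_gInv hf hdet k l).mul
    ((((contDiffAt_gInd hf l j).pd_infty i).add ((contDiffAt_gInd hf l i).pd_infty j)).sub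
      ((contDiffAt_gInd hf i j).pd_infty l))

theorem contDiffAt_sff (hf : ContDiffAt ℝ ∞ f x) (hdet : (gMat f x).det ≠ 0) (α : Fin n)
    (i j : Fin m) : ContDiffAt ℝ ∞ (sff f α i j) x :=
  (hf.Fdd (by simp) α i j).sub <| ContDiffAt.sum fun k _ =>
    (contDiffAt_chr hf hdet k i j).mul (hf.Fd (by simp) α k)

theorem eventually_det_ne_zero (hf : ContDiffAt ℝ 1 f x) (hdet : (gMat f x).det ≠ 0) :
    ∀ᶠ y in 𝓝 x, (gMat f y).det ≠ 0 := by
  have hc : ContinuousAt (fun y => gMat f y) x := by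
    refine continuousAt_pi.2 fun i => continuousAt_pi.2 fun j => ?_
    show ContinuousAt (fun y => ∑ α, Fd f α i y * Fd f α j y) x
    exact tendsto_finsetSum _ fun α _ => (hf.Fd (k := 0) (by norm_num) α i).continuousAt.mul
      (hf.Fd (k := 0) (by norm_num) α j).continuousAt
  have hd : ContinuousAt (fun y => (gMat f y).det) x :=
    (Continuous.matrix_det continuous_id).continuousAt.comp hc
  exact hd.eventually_ne hdet

end Pointwise

section Graph

variable {m n : ℕ} {f : (Fin m → ℝ) → (Fin n → ℝ)} {x : Fin m → ℝ}

/-- `f` is near `x` a graph over its tangent space at `x`, parametrised by orthonormal coordinates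
of that space. -/
structure IsGraphAt (f : (Fin m → ℝ) → (Fin n → ℝ)) (x : Fin m → ℝ) : Prop where
  contDiffAt : ContDiffAt ℝ ∞ f x
  eventually_eq : ∀ᶠ y in 𝓝 x, ∀ i, ∑ α, Fd f α i x * f y α = y i

namespace IsGraphAt

variable (h : IsGraphAt f x)
include h

theorem contDiffAt_Fd (α : Fin n) (i : Fin m) : ContDiffAt ℝ ∞ (Fd f α i) x :=
  h.contDiffAt.Fd (by simp) α i

theorem contDiffAt_Fdd (α : Fin n) (i j : Fin m) : ContDiffAt ℝ ∞ (Fdd f α i j) x :=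
  h.contDiffAt.Fdd (by simp) α i j

theorem contDiffAt_two : ContDiffAt ℝ 2 f x :=
  (h.contDiffAt.eventually_of_infty 2).self_of_nhds

theorem eventually_two : ∀ᶠ y in 𝓝 x, ContDiffAt ℝ 2 f y :=
  h.contDiffAt.eventually_of_infty 2

theorem eventually_Fd (i j : Fin m) :
    ∀ᶠ y in 𝓝 x, ∑ α, Fd f α i x * Fd f α j y = if i = j then 1 else 0 := by
  filter_upwards [h.eventually_eq.eventually_nhds, h.eventually_two] with y hy h2
  have hd : ∀ α, DifferentiableAt ℝ (fun z => f z α) y := fun α =>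
    (contDiffAt_pi.1 h2 α).differentiableAt (by simp)
  have : (fun z => ∑ α, Fd f α i x * f z α) =ᶠ[𝓝 y] fun z => z i := hy.mono fun z hz => hz i
  have := pd_congr this j
  rw [pd_coord, pd_sum fun α _ => (hd α).const_mul _] at this
  rw [← this]
  exact sum_congr rfl fun α _ => (pd_const_mul _ (hd α) j).symm

theorem eventually_Fdd (i j k : Fin m) :
    ∀ᶠ y in 𝓝 x, ∑ α, Fd f α i x * Fdd f α j k y = 0 := by
  filter_upwards [(h.eventually_Fd i k).eventually_nhds, h.eventually_two] with y hy h2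
  have hd : ∀ α, DifferentiableAt ℝ (Fd f α k) y := fun α =>
    (h2.Fd (k := 1) (by norm_num) α k).differentiableAt (by simp)
  have := pd_congr hy j
  rw [pd_const, pd_sum fun α _ => (hd α).const_mul _] at this
  rw [← this]
  exact sum_congr rfl fun α _ => (pd_const_mul _ (hd α) j).symm

theorem Fd_dot_Fd (i j : Fin m) : ∑ α, Fd f α i x * Fd f α j x = if i = j then 1 else 0 :=
  (h.eventually_Fd i j).self_of_nhds

theorem Fd_dot_Fdd (i j k : Fin m) : ∑ α, Fd f α i x * Fdd f α j k x = 0 :=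
  (h.eventually_Fdd i j k).self_of_nhds

theorem Fdd_dot_Fd (i j k : Fin m) : ∑ α, Fdd f α j k x * Fd f α i x = 0 := by
  simpa only [mul_comm] using h.Fd_dot_Fdd i j k

theorem Fd_dot_Fddd (i j k l : Fin m) : ∑ α, Fd f α i x * pd (Fdd f α j k) l x = 0 := by
  have hd : ∀ α, DifferentiableAt ℝ (Fdd f α j k) x := fun α =>
    (h.contDiffAt_Fdd α j k).diff_of_infty
  have := pd_congr (h.eventually_Fdd i j k) l
  rw [pd_const, pd_sum fun α _ => (hd α).const_mul _] at this
  rw [← this]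
  exact sum_congr rfl fun α _ => (pd_const_mul _ (hd α) l).symm

theorem Fddd_dot_Fd (i j k l : Fin m) : ∑ α, pd (Fdd f α j k) l x * Fd f α i x = 0 := by
  simpa only [mul_comm] using h.Fd_dot_Fddd i j k l

theorem gInd_eq (i j : Fin m) : gInd f i j x = if i = j then 1 else 0 :=
  h.Fd_dot_Fd i j

theorem gMat_eq : gMat f x = 1 := by
  ext i j
  rw [Matrix.one_apply]
  exact h.gInd_eq i j

theorem det_ne_zero : (gMat f x).det ≠ 0 := by
  simp [h.gMat_eq]

theorem gInv_eq (i j : Fin m) : gInv f i j x = if i = j then 1 else 0 := by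
  rw [gInv, h.gMat_eq, inv_one, Matrix.one_apply]

theorem pd_gInd_eq (i j k : Fin m) : pd (gInd f i j) k x = 0 := by
  rw [pd_gInd h.contDiffAt_two, sum_add_distrib, h.Fdd_dot_Fd, h.Fd_dot_Fdd, add_zero]

theorem pd_pd_gInd_eq (i j k l : Fin m) : pd (pd (gInd f i j) k) l x =
    ∑ α, (Fdd f α k i x * Fdd f α l j x + Fdd f α l i x * Fdd f α k j x) := by
  show pd (pd (fun y => ∑ α, Fd f α i y * Fd f α j y) k) l x = _
  rw [pd_pd_sum fun α _ => (h.contDiffAt_Fd α i).mul (h.contDiffAt_Fd α j)]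
  simp_rw [fun α => pd_pd_mul (h.contDiffAt_Fd α i) (h.contDiffAt_Fd α j) k l]
  have h1 := h.Fddd_dot_Fd j k i l
  have h2 := h.Fd_dot_Fddd i k j l
  simp only [sum_add_distrib] at *
  rw [show (∑ α, pd (pd (Fd f α i) k) l x * Fd f α j x) = 0 from h1,
    show (∑ α, Fd f α i x * pd (pd (Fd f α j) k) l x) = 0 from h2]
  simp only [zero_add, add_zero]
  rfl

theorem contDiffAt_gInv' (i j : Fin m) : ContDiffAt ℝ ∞ (gInv f i j) x :=
  contDiffAt_gInv h.contDiffAt h.det_ne_zero i j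

theorem contDiffAt_chr' (k i j : Fin m) : ContDiffAt ℝ ∞ (chr f k i j) x :=
  contDiffAt_chr h.contDiffAt h.det_ne_zero k i j

theorem contDiffAt_sff' (α : Fin n) (i j : Fin m) : ContDiffAt ℝ ∞ (sff f α i j) x :=
  contDiffAt_sff h.contDiffAt h.det_ne_zero α i j

theorem eventually_gInv_mul (i j : Fin m) :
    (fun y => ∑ k, gInv f i k y * gInd f k j y) =ᶠ[𝓝 x] fun _ => if i = j then 1 else 0 := by
  filter_upwards [eventually_det_ne_zero (h.contDiffAt.of_le (by simp)) h.det_ne_zero] with y hy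
    using gInv_mul_gInd hy i j

theorem pd_gInv_eq (i j k : Fin m) : pd (gInv f i j) k x = 0 := by
  have := pd_congr (h.eventually_gInv_mul i j) k
  rw [pd_const, pd_sum fun a _ => (h.contDiffAt_gInv' i a).diff_of_infty.fun_mul
    (contDiffAt_gInd h.contDiffAt a j).diff_of_infty] at this
  simp_rw [fun a => pd_mul (h.contDiffAt_gInv' i a).diff_of_infty
    (contDiffAt_gInd h.contDiffAt a j).diff_of_infty k, h.gInd_eq, h.pd_gInd_eq] at this
  simpa using this

theorem pd_pd_gInv_eq (i j k l : Fin m) : pd (pd (gInv f i j) k) l x =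
    -∑ α, (Fdd f α k i x * Fdd f α l j x + Fdd f α l i x * Fdd f α k j x) := by
  have := pd_congr ((h.eventually_gInv_mul i j).pd k) l
  rw [pd_pd_sum fun a _ => (h.contDiffAt_gInv' i a).mul (contDiffAt_gInd h.contDiffAt a j)] at this
  simp_rw [fun a => pd_pd_mul (h.contDiffAt_gInv' i a)
    (contDiffAt_gInd h.contDiffAt a j) k l, h.gInd_eq, h.pd_gInd_eq, h.pd_gInv_eq, h.gInv_eq,
    h.pd_pd_gInd_eq] at this
  have hc : pd (pd (fun _ => if i = j then (1 : ℝ) else 0) k) l x = 0 := by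
    rw [show pd (fun _ => if i = j then (1 : ℝ) else 0) k = fun _ => 0 from
      funext fun _ => pd_const _ k, pd_const]
  rw [hc] at this
  simp only [mul_ite, mul_one, mul_zero, zero_mul, add_zero, ite_mul, one_mul, sum_add_distrib,
    sum_ite_eq, sum_ite_eq', mem_univ, if_true] at this
  simp only [sum_add_distrib]
  linarith

theorem chr_eq_zero (k i j : Fin m) : chr f k i j x = 0 := by
  simp [chr_eq h.contDiffAt_two, h.Fdd_dot_Fd]

theorem pd_chr_eq (k i j p : Fin m) :
    pd (chr f k i j) p x = ∑ α, Fdd f α i j x * Fdd f α p k x := by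
  have : chr f k i j =ᶠ[𝓝 x] fun y => ∑ l, gInv f k l y * ∑ α, Fdd f α i j y * Fd f α l y := by
    filter_upwards [h.eventually_two] with y hy using chr_eq hy k i j
  have hC : ∀ l α, ContDiffAt ℝ ∞ (fun y => Fdd f α i j y * Fd f α l y) x := fun l α =>
    (h.contDiffAt_Fdd α i j).mul (h.contDiffAt_Fd α l)
  have hC' : ∀ l, ContDiffAt ℝ ∞ (fun y => ∑ α, Fdd f α i j y * Fd f α l y) x := fun l =>
    ContDiffAt.sum fun α _ => hC l α
  have hpC : ∀ l, pd (fun y => ∑ α, Fdd f α i j y * Fd f α l y) p x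
      = ∑ α, Fdd f α i j x * Fdd f α p l x := by
    intro l
    rw [pd_sum fun α _ => (hC l α).diff_of_infty]
    simp_rw [fun α => pd_mul (h.contDiffAt_Fdd α i j).diff_of_infty
      (h.contDiffAt_Fd α l).diff_of_infty p, sum_add_distrib, h.Fddd_dot_Fd, zero_add]
    rfl
  rw [pd_congr this, pd_sum fun l _ => ((h.contDiffAt_gInv' k l).mul (hC' l)).diff_of_infty]
  simp_rw [fun l => pd_mul (h.contDiffAt_gInv' k l).diff_of_infty (hC' l).diff_of_infty p,
    h.pd_gInv_eq, h.gInv_eq, hpC]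
  simp

theorem sff_eq_Fdd (α : Fin n) (i j : Fin m) : sff f α i j x = Fdd f α i j x := by
  simp [sff_eq, h.chr_eq_zero]

theorem pd_sff_eq (α : Fin n) (i j p : Fin m) : pd (sff f α i j) p x =
    pd (Fdd f α i j) p x - ∑ k, (∑ β, Fdd f β i j x * Fdd f β p k x) * Fd f α k x := by
  show pd (fun y => Fdd f α i j y - ∑ k, chr f k i j y * Fd f α k y) p x = _
  have hk : ∀ k, ContDiffAt ℝ ∞ (fun y => chr f k i j y * Fd f α k y) x := fun k =>
    (h.contDiffAt_chr' k i j).mul (h.contDiffAt_Fd α k)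
  rw [pd_sub (h.contDiffAt_Fdd α i j).diff_of_infty
    (ContDiffAt.sum fun k _ => hk k).diff_of_infty, pd_sum fun k _ => (hk k).diff_of_infty]
  simp_rw [fun k => pd_mul (h.contDiffAt_chr' k i j).diff_of_infty
    (h.contDiffAt_Fd α k).diff_of_infty p, h.chr_eq_zero, h.pd_chr_eq, zero_mul, add_zero]

theorem pd_pd_sff_eq (α : Fin n) (i j p q : Fin m) : pd (pd (sff f α i j) p) q x =
    pd (pd (Fdd f α i j) p) q x - ∑ k, (pd (pd (chr f k i j) p) q x * Fd f α k x
      + (∑ β, Fdd f β i j x * Fdd f β p k x) * Fdd f α q k x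
      + (∑ β, Fdd f β i j x * Fdd f β q k x) * Fdd f α p k x) := by
  show pd (pd (fun y => Fdd f α i j y - ∑ k, chr f k i j y * Fd f α k y) p) q x = _
  have hk : ∀ k, ContDiffAt ℝ ∞ (fun y => chr f k i j y * Fd f α k y) x := fun k =>
    (h.contDiffAt_chr' k i j).mul (h.contDiffAt_Fd α k)
  rw [pd_pd_sub (h.contDiffAt_Fdd α i j) (ContDiffAt.sum fun k _ => hk k),
    pd_pd_sum fun k _ => hk k]
  simp_rw [fun k => pd_pd_mul (h.contDiffAt_chr' k i j) (h.contDiffAt_Fd α k) p q, h.chr_eq_zero,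
    h.pd_chr_eq, zero_mul, add_zero]
  rfl

end IsGraphAt

end Graph

section GraphLaplacian

variable {m n : ℕ} {f : (Fin m → ℝ) → (Fin n → ℝ)} {x : Fin m → ℝ}

/-- Inner products `⟨F_{ij}, F_{kl}⟩` of second partial derivatives. -/
def hessDot (f : (Fin m → ℝ) → (Fin n → ℝ)) (x : Fin m → ℝ) (i j k l : Fin m) : ℝ :=
  ∑ α, Fdd f α i j x * Fdd f α k l x

theorem hessDot_swap (i j k l : Fin m) : hessDot f x i j k l = hessDot f x k l i j :=
  sum_congr rfl fun _ _ => mul_comm _ _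

theorem normA2_eq : normA2 f = fun y => ∑ i, ∑ j, ∑ k, ∑ l,
    (gInv f i k y * gInv f j l y) * ∑ α, sff f α i j y * sff f α k l y := by
  funext y
  rw [normA2, sum_comm]
  refine sum_congr rfl fun i _ => ?_
  rw [sum_comm]
  refine sum_congr rfl fun j _ => ?_
  rw [sum_comm]
  refine sum_congr rfl fun k _ => ?_
  rw [sum_comm]
  refine sum_congr rfl fun l _ => ?_
  rw [mul_sum]
  exact sum_congr rfl fun α _ => by ring

namespace IsGraphAt

variable (h : IsGraphAt f x)
include h

theorem hessDot_left (i j k l : Fin m) : hessDot f x i j k l = hessDot f x j i k l :=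
  sum_congr rfl fun α _ => by rw [Fdd_symm h.contDiffAt_two α i j]

theorem hessDot_right (i j k l : Fin m) : hessDot f x i j k l = hessDot f x i j l k :=
  sum_congr rfl fun α _ => by rw [Fdd_symm h.contDiffAt_two α k l]

theorem pd_sff_dot (i j p k : Fin m) :
    ∑ α, pd (sff f α i j) p x * Fd f α k x = -hessDot f x i j p k := by
  have h1 : ∀ α, pd (sff f α i j) p x * Fd f α k x = pd (Fdd f α i j) p x * Fd f α k x
      - ∑ l, hessDot f x i j p l * (Fd f α l x * Fd f α k x) := by
    intro α
    rw [h.pd_sff_eq, sub_mul, sum_mul]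
    exact congrArg _ (sum_congr rfl fun l _ => mul_assoc _ _ _)
  simp_rw [h1, sum_sub_distrib]
  rw [sum_comm]
  simp_rw [← mul_sum, h.Fd_dot_Fd, h.Fddd_dot_Fd]
  simp

theorem pd_sff_sq (i j p : Fin m) :
    ∑ α, pd (sff f α i j) p x * pd (sff f α i j) p x =
      ∑ α, pd (Fdd f α i j) p x * pd (Fdd f α i j) p x + ∑ k, hessDot f x i j p k ^ 2 := by
  have h1 : ∀ α, pd (sff f α i j) p x * pd (sff f α i j) p x
      = pd (Fdd f α i j) p x * pd (Fdd f α i j) p x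
        - ∑ k, hessDot f x i j p k * (pd (Fdd f α i j) p x * Fd f α k x)
        - ∑ k, hessDot f x i j p k * (pd (sff f α i j) p x * Fd f α k x) := by
    intro α
    have h2 : pd (sff f α i j) p x
      = pd (Fdd f α i j) p x - ∑ k, hessDot f x i j p k * Fd f α k x := h.pd_sff_eq α i j p
    have h3 : ∀ c : ℝ, ∑ k, hessDot f x i j p k * (c * Fd f α k x)
        = c * ∑ k, hessDot f x i j p k * Fd f α k x := by
      intro c
      rw [mul_sum]
      exact sum_congr rfl fun k _ => by ring
    rw [h3, h3, h2]
    ring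
  simp_rw [h1, sum_sub_distrib]
  rw [sum_comm, sum_comm (f := fun α k =>
    hessDot f x i j p k * (pd (sff f α i j) p x * Fd f α k x))]
  simp_rw [← mul_sum, h.Fddd_dot_Fd, h.pd_sff_dot]
  simp [pow_two]

theorem pd_pd_sff_dot (i j p q a b : Fin m) :
    ∑ α, pd (pd (sff f α i j) p) q x * Fdd f α a b x =
      ∑ α, pd (pd (Fdd f α i j) p) q x * Fdd f α a b x
        - ∑ k, (hessDot f x i j p k * hessDot f x q k a b
          + hessDot f x i j q k * hessDot f x p k a b) := by
  have h1 : ∀ α, pd (pd (sff f α i j) p) q x * Fdd f α a b x =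
      pd (pd (Fdd f α i j) p) q x * Fdd f α a b x
      - ∑ k, (pd (pd (chr f k i j) p) q x * (Fd f α k x * Fdd f α a b x)
        + hessDot f x i j p k * (Fdd f α q k x * Fdd f α a b x)
        + hessDot f x i j q k * (Fdd f α p k x * Fdd f α a b x)) := by
    intro α
    rw [h.pd_pd_sff_eq, sub_mul, sum_mul]
    congr 1
    refine sum_congr rfl fun k _ => ?_
    simp only [hessDot]
    ring
  simp_rw [h1, sum_sub_distrib]
  rw [sum_comm]
  simp_rw [sum_add_distrib, ← mul_sum, h.Fd_dot_Fdd]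
  simp only [mul_zero, sum_const_zero, zero_add]
  rfl

theorem pd_pd_normA2 (p : Fin m) : pd (pd (normA2 f) p) p x =
    ∑ i, ∑ j, (2 * ∑ α, pd (pd (Fdd f α i j) p) p x * Fdd f α i j x
      + 2 * ∑ α, pd (Fdd f α i j) p x * pd (Fdd f α i j) p x
      - 2 * ∑ k, hessDot f x i j p k ^ 2)
    - 4 * ∑ i, ∑ j, ∑ k, hessDot f x p i p k * hessDot f x i j k j := by
  have hA := h.contDiffAt_sff'
  have hG := h.contDiffAt_gInv'
  have hD : ∀ i j k l, ContDiffAt ℝ ∞ (fun y => ∑ α, sff f α i j y * sff f α k l y) x :=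
    fun i j k l => ContDiffAt.sum fun α _ => (hA α i j).mul (hA α k l)
  have hGG : ∀ i j k l, ContDiffAt ℝ ∞ (fun y => gInv f i k y * gInv f j l y) x :=
    fun i j k l => (hG i k).mul (hG j l)
  have h4 : ∀ i j k l, ContDiffAt ℝ ∞
      (fun y => (gInv f i k y * gInv f j l y) * ∑ α, sff f α i j y * sff f α k l y) x :=
    fun i j k l => (hGG i j k l).mul (hD i j k l)
  have h3 := fun i j k => ContDiffAt.sum (s := univ) fun l _ => h4 i j k l
  have h2 := fun i j => ContDiffAt.sum (s := univ) fun k _ => h3 i j k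
  have h1 := fun i => ContDiffAt.sum (s := univ) fun j _ => h2 i j
  have hsecond : ∀ i k, pd (pd (gInv f i k) p) p x = -2 * hessDot f x p i p k := by
    intro i k
    rw [h.pd_pd_gInv_eq, hessDot, mul_sum, ← sum_neg_distrib]
    exact sum_congr rfl fun α _ => by ring
  have hGG1 : ∀ i j k l, pd (fun y => gInv f i k y * gInv f j l y) p x = 0 := by
    intro i j k l
    rw [pd_mul (hG i k).diff_of_infty (hG j l).diff_of_infty, h.pd_gInv_eq, h.pd_gInv_eq]
    ring
  have hGG2 : ∀ i j k l, pd (pd (fun y => gInv f i k y * gInv f j l y) p) p x =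
      (-2 * hessDot f x p i p k) * (if j = l then 1 else 0)
        + (if i = k then 1 else 0) * (-2 * hessDot f x p j p l) := by
    intro i j k l
    rw [pd_pd_mul (hG i k) (hG j l), h.pd_gInv_eq, h.pd_gInv_eq, h.gInv_eq, h.gInv_eq, hsecond,
      hsecond]
    ring
  have hD0 : ∀ i j k l, ∑ α, sff f α i j x * sff f α k l x = hessDot f x i j k l := by
    intro i j k l
    simp_rw [h.sff_eq_Fdd]
    rfl
  have hD2 : ∀ i j, pd (pd (fun y => ∑ α, sff f α i j y * sff f α i j y) p) p x =
      2 * ∑ α, pd (pd (Fdd f α i j) p) p x * Fdd f α i j x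
      + 2 * ∑ α, pd (Fdd f α i j) p x * pd (Fdd f α i j) p x
      - 2 * ∑ k, hessDot f x i j p k ^ 2 := by
    intro i j
    rw [pd_pd_sum fun α _ => (hA α i j).mul (hA α i j)]
    simp_rw [fun α => pd_pd_mul (hA α i j) (hA α i j) p p]
    have e1 := h.pd_sff_sq i j p
    have e2 := h.pd_pd_sff_dot i j p p i j
    simp_rw [hessDot_swap p _ i j, ← pow_two, ← two_mul] at e2
    rw [← mul_sum] at e2
    have e3 : ∑ α, (pd (pd (sff f α i j) p) p x * sff f α i j x
        + pd (sff f α i j) p x * pd (sff f α i j) p x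
        + pd (sff f α i j) p x * pd (sff f α i j) p x
        + sff f α i j x * pd (pd (sff f α i j) p) p x)
        = 2 * ∑ α, pd (pd (sff f α i j) p) p x * Fdd f α i j x
          + 2 * ∑ α, pd (sff f α i j) p x * pd (sff f α i j) p x := by
      rw [mul_sum, mul_sum, ← sum_add_distrib]
      refine sum_congr rfl fun α _ => ?_
      rw [h.sff_eq_Fdd]
      ring
    rw [e3, e2, e1]
    ring
  rw [normA2_eq, pd_pd_sum fun i _ => h1 i]
  simp_rw [fun i => pd_pd_sum (s := univ) (fun j _ => h2 i j) p p,
    fun i j => pd_pd_sum (s := univ) (fun k _ => h3 i j k) p p,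
    fun i j k => pd_pd_sum (s := univ) (fun l _ => h4 i j k l) p p,
    fun i j k l => pd_pd_mul (hGG i j k l) (hD i j k l) p p, hGG1, hGG2, hD0, h.gInv_eq]
  simp only [zero_mul, add_zero, mul_ite, mul_one, mul_zero, ite_mul, one_mul, add_mul,
    sum_add_distrib, sum_ite_eq, mem_univ, if_true, hD2, sum_sub_distrib]
  have e : ∑ i, ∑ j, ∑ k, ∑ l,
      (if i = k then -2 * hessDot f x p j p l * hessDot f x i j k l else 0) =
      ∑ i, ∑ j, ∑ k, -2 * hessDot f x p i p k * hessDot f x i j k j := by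
    rw [sum_comm]
    refine sum_congr rfl fun j _ => sum_congr rfl fun i _ => ?_
    rw [sum_comm]
    refine sum_congr rfl fun l _ => ?_
    simp only [sum_ite_eq, mem_univ, if_true]
    rw [h.hessDot_left i j, h.hessDot_right j i i l]
  have e' : ∑ i, ∑ j, ∑ k, -2 * hessDot f x p i p k * hessDot f x i j k j =
      -2 * ∑ i, ∑ j, ∑ k, hessDot f x p i p k * hessDot f x i j k j := by
    simp only [mul_sum, mul_assoc]
  rw [e, e']
  ring

end IsGraphAt
end GraphLaplacian

theorem sum_sum_comm_sum_sum {ι κ : Type*} [Fintype ι] [Fintype κ] (u : κ → κ → ι → ι → ℝ) :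
    ∑ α, ∑ β, ∑ p, ∑ q, u α β p q = ∑ p, ∑ q, ∑ α, ∑ β, u α β p q :=
  calc _ = ∑ α, ∑ p, ∑ q, ∑ β, u α β p q :=
        sum_congr rfl fun _ _ => sum_comm.trans (sum_congr rfl fun _ _ => sum_comm)
    _ = _ := sum_comm.trans (sum_congr rfl fun _ _ => sum_comm)

theorem sum_mul_sum_mul_sum {ι κ : Type*} [Fintype ι] [Fintype κ] (a b c d : ι → κ → ℝ) :
    ∑ α, ∑ β, (∑ p, a p α * b p β) * (∑ q, c q α * d q β) =
      ∑ p, ∑ q, (∑ α, a p α * c q α) * (∑ β, b p β * d q β) := by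
  simp_rw [sum_mul_sum]
  rw [sum_sum_comm_sum_sum]
  exact sum_congr rfl fun p _ => sum_congr rfl fun q _ => sum_congr rfl fun α _ =>
    sum_congr rfl fun β _ => by ring

section GraphQuantities

variable {m n : ℕ} {f : (Fin m → ℝ) → (Fin n → ℝ)} {x : Fin m → ℝ}

namespace IsGraphAt

variable (h : IsGraphAt f x)
include h

theorem lapBel_eq (u : (Fin m → ℝ) → ℝ) : lapBel f u x = ∑ p, pd (pd u p) p x := by
  simp only [lapBel, h.gInv_eq, h.chr_eq_zero, zero_mul, sum_const_zero, sub_zero, ite_mul,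
    one_mul, sum_ite_eq, mem_univ, if_true]

theorem nperpA_eq (l : Fin m) (α : Fin n) (i j : Fin m) :
    nperpA f l α i j x = pd (Fdd f α i j) l x := by
  have e1 : covA f l α i j x = pd (sff f α i j) l x := by
    simp only [covA, h.chr_eq_zero, zero_mul, sum_const_zero, sub_zero]
  have e2 : ∑ β, ∑ k, ∑ p, sff f β i j x * gInv f k p x * sff f β p l x * Fd f α k x
      = ∑ k, (∑ β, Fdd f β i j x * Fdd f β l k x) * Fd f α k x := by
    rw [sum_comm]
    refine sum_congr rfl fun k _ => ?_
    rw [sum_mul]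
    refine sum_congr rfl fun β _ => ?_
    simp only [h.gInv_eq, mul_ite, mul_one, mul_zero, ite_mul, zero_mul, sum_ite_eq, mem_univ,
      if_true, h.sff_eq_Fdd]
    rw [Fdd_symm h.contDiffAt_two β k l]
  rw [nperpA, e1, e2, h.pd_sff_eq]
  ring

theorem normNperpA2_eq : normNperpA2 f x =
    ∑ p, ∑ i, ∑ j, ∑ α, pd (Fdd f α i j) p x * pd (Fdd f α i j) p x := by
  simp only [normNperpA2, h.gInv_eq, h.nperpA_eq, mul_ite, mul_one, mul_zero, ite_mul, zero_mul,
    sum_ite_eq, mem_univ, if_true, one_mul]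
  have (α : Fin n) : (∑ l, ∑ l', ∑ i, ∑ i', ∑ j, if i = i' then if l = l' then
      pd (Fdd f α i j) l x * pd (Fdd f α i' j) l' x else 0 else 0)
      = ∑ l, ∑ i, ∑ j, pd (Fdd f α i j) l x * pd (Fdd f α i j) l x := by
    refine sum_congr rfl fun l _ => ?_
    rw [sum_eq_single l]
    · refine sum_congr rfl fun i _ => ?_
      rw [sum_eq_single i]
      · simp
      · intro b _ hb
        simp [hb.symm]
      · simp
    · intro b _ hb
      simp [hb.symm]
    · simp
  simp only [this]
  rw [sum_comm]
  refine sum_congr rfl fun l _ => ?_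
  rw [sum_comm]
  refine sum_congr rfl fun i _ => ?_
  rw [sum_comm]

theorem normSsf2_eq : normSsf2 f x = ∑ i, ∑ j, ∑ k, ∑ l, hessDot f x i j k l ^ 2 := by
  have e : ∀ α β, ssf f α β x =
      ∑ p : Fin m × Fin m, Fdd f α p.1 p.2 x * Fdd f β p.1 p.2 x := by
    intro α β
    rw [Fintype.sum_prod_type]
    simp only [ssf, h.gInv_eq, ite_mul, one_mul, zero_mul, sum_ite_eq, mem_univ, if_true,
      h.sff_eq_Fdd, Fdd_symm h.contDiffAt_two β]
  simp only [normSsf2, e, pow_two]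
  rw [sum_mul_sum_mul_sum (fun (p : Fin m × Fin m) α => Fdd f α p.1 p.2 x)
    (fun p α => Fdd f α p.1 p.2 x) (fun p α => Fdd f α p.1 p.2 x) (fun p α => Fdd f α p.1 p.2 x)]
  simp only [Fintype.sum_prod_type]
  rfl

theorem norP_eq (α β : Fin n) :
    norP f α β x = (if α = β then 1 else 0) - ∑ k, Fd f α k x * Fd f β k x := by
  simp only [norP, tanP, h.gInv_eq, ite_mul, one_mul, zero_mul, sum_ite_eq, mem_univ, if_true]

theorem dnorP_eq (i : Fin m) (α β : Fin n) : dnorP f i α β x =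
    -∑ k, (Fdd f α i k x * Fd f β k x + Fd f α k x * Fdd f β i k x) := by
  have h1 : ∀ k l, ContDiffAt ℝ ∞ (fun y => gInv f k l y * Fd f α k y) x := fun k l =>
    (h.contDiffAt_gInv' k l).mul (h.contDiffAt_Fd α k)
  have h2 : ∀ k l, ContDiffAt ℝ ∞ (fun y => gInv f k l y * Fd f α k y * Fd f β l y) x := fun k l =>
    (h1 k l).mul (h.contDiffAt_Fd β l)
  have h3 := fun k => ContDiffAt.sum (s := univ) fun l _ => h2 k l
  show pd (fun y => (if α = β then 1 else 0)
    - ∑ k, ∑ l, gInv f k l y * Fd f α k y * Fd f β l y) i x = _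
  rw [pd_sub (differentiableAt_const _) (ContDiffAt.sum fun k _ => h3 k).diff_of_infty, pd_const,
    pd_sum fun k _ => (h3 k).diff_of_infty, zero_sub]
  congr 1
  refine sum_congr rfl fun k _ => ?_
  rw [pd_sum fun l _ => (h2 k l).diff_of_infty]
  simp_rw [fun l => pd_mul (h1 k l).diff_of_infty (h.contDiffAt_Fd β l).diff_of_infty i,
    fun l => pd_mul (h.contDiffAt_gInv' k l).diff_of_infty (h.contDiffAt_Fd α k).diff_of_infty i,
    h.pd_gInv_eq, h.gInv_eq, zero_mul, zero_add, ite_mul, one_mul, zero_mul, sum_add_distrib,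
    sum_ite_eq, mem_univ, if_true]
  rfl

theorem norP_mul_dnorP (i : Fin m) (α δ : Fin n) :
    ∑ γ, norP f α γ x * dnorP f i γ δ x = -∑ k, Fdd f α i k x * Fd f δ k x := by
  have e1 : ∀ k, ∑ γ, norP f α γ x * Fd f γ k x = 0 := by
    intro k
    simp_rw [h.norP_eq, sub_mul, sum_sub_distrib, ite_mul, one_mul, zero_mul, sum_ite_eq,
      mem_univ, if_true, sum_mul]
    rw [sum_comm]
    simp_rw [mul_assoc, ← mul_sum, h.Fd_dot_Fd]
    simp
  have e2 : ∀ k, ∑ γ, norP f α γ x * Fdd f γ i k x = Fdd f α i k x := by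
    intro k
    simp_rw [h.norP_eq, sub_mul, sum_sub_distrib, ite_mul, one_mul, zero_mul, sum_ite_eq,
      mem_univ, if_true, sum_mul]
    rw [sum_comm]
    simp_rw [mul_assoc, ← mul_sum, h.Fd_dot_Fdd]
    simp
  have e3 : ∀ γ, norP f α γ x * dnorP f i γ δ x
      = -∑ k, ((norP f α γ x * Fdd f γ i k x) * Fd f δ k x
        + (norP f α γ x * Fd f γ k x) * Fdd f δ i k x) := by
    intro γ
    rw [h.dnorP_eq, mul_neg, mul_sum]
    exact congrArg _ (sum_congr rfl fun k _ => by ring)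
  simp_rw [e3, sum_neg_distrib]
  rw [sum_comm]
  simp_rw [sum_add_distrib, ← sum_mul, e1, e2]
  simp

theorem dnorP_mul_norP (i : Fin m) (α δ : Fin n) :
    ∑ γ, dnorP f i δ γ x * norP f γ α x = -∑ k, Fdd f α i k x * Fd f δ k x := by
  rw [← h.norP_mul_dnorP]
  refine sum_congr rfl fun γ _ => ?_
  rw [mul_comm, h.dnorP_eq, h.dnorP_eq, h.norP_eq, h.norP_eq]
  congr 2
  · simp only [eq_comm]
  · exact sum_congr rfl fun _ _ => mul_comm _ _
  · refine sum_congr rfl fun _ _ => by ring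

theorem normCurv_eq (α β : Fin n) (i j : Fin m) : normCurv f α β i j x =
    ∑ k, (Fdd f α i k x * Fdd f β j k x - Fdd f α j k x * Fdd f β i k x) := by
  have key : ∀ i j, ∑ γ, ∑ δ, ∑ ε,
      norP f α γ x * (dnorP f i γ δ x * dnorP f j δ ε x) * norP f ε β x
      = ∑ k, Fdd f α i k x * Fdd f β j k x := by
    intro i j
    have e1 : ∑ γ, ∑ δ, ∑ ε,
      norP f α γ x * (dnorP f i γ δ x * dnorP f j δ ε x) * norP f ε β x
      = ∑ δ, (∑ γ, norP f α γ x * dnorP f i γ δ x) * ∑ ε, dnorP f j δ ε x * norP f ε β x := by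
      rw [sum_comm]
      refine sum_congr rfl fun δ _ => ?_
      rw [sum_mul_sum]
      exact sum_congr rfl fun γ _ => sum_congr rfl fun ε _ => by ring
    simp_rw [e1, h.norP_mul_dnorP, h.dnorP_mul_norP, neg_mul_neg, sum_mul_sum]
    rw [sum_comm]
    refine sum_congr rfl fun k _ => ?_
    rw [sum_comm]
    have e2 : ∀ l δ, Fdd f α i k x * Fd f δ k x * (Fdd f β j l x * Fd f δ l x) =
        Fdd f α i k x * Fdd f β j l x * (Fd f δ k x * Fd f δ l x) := fun l δ => by ring
    simp_rw [e2, ← mul_sum, h.Fd_dot_Fd]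
    simp
  rw [normCurv, sum_sub_distrib, ← key i j, ← key j i]
  simp only [mul_sub, sub_mul, sum_sub_distrib]

theorem normRperp2_eq : normRperp2 f x = 2 * ∑ i, ∑ j, ∑ k, ∑ l,
    (hessDot f x i k i l * hessDot f x j k j l - hessDot f x i k j l * hessDot f x j k i l) := by
  have e : ∀ i j, ∑ α, ∑ β, normCurv f α β i j x * normCurv f α β i j x = ∑ k, ∑ l,
      2 * (hessDot f x i k i l * hessDot f x j k j l
        - hessDot f x i k j l * hessDot f x j k i l) := by
    intro i j
    have e1 := sum_mul_sum_mul_sum (fun k α => Fdd f α i k x) (fun k α => Fdd f α j k x)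
    have e2 := e1 (fun k α => Fdd f α i k x) (fun k α => Fdd f α j k x)
    have e3 := e1 (fun k α => Fdd f α j k x) (fun k α => Fdd f α i k x)
    have e4 := sum_mul_sum_mul_sum (fun k α => Fdd f α j k x) (fun k α => Fdd f α i k x)
      (fun k α => Fdd f α j k x) (fun k α => Fdd f α i k x)
    have e5 : ∀ α β, normCurv f α β i j x * normCurv f α β i j x =
        (∑ k, Fdd f α i k x * Fdd f β j k x) * (∑ k, Fdd f α i k x * Fdd f β j k x)
        + (∑ k, Fdd f α j k x * Fdd f β i k x) * (∑ k, Fdd f α j k x * Fdd f β i k x)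
        - 2 * ((∑ k, Fdd f α i k x * Fdd f β j k x) * ∑ k, Fdd f α j k x * Fdd f β i k x) := by
      intro α β
      rw [h.normCurv_eq, sum_sub_distrib]
      ring
    have e6 : ∀ A B C : Fin m → Fin m → ℝ, ∑ k, ∑ l, A k l + ∑ k, ∑ l, B k l
        - 2 * ∑ k, ∑ l, C k l = ∑ k, ∑ l, (A k l + B k l - 2 * C k l) := by
      intro A B C
      simp only [sum_add_distrib, sum_sub_distrib, mul_sum]
    conv_lhs => simp only [e5, sum_sub_distrib, sum_add_distrib, ← mul_sum]
    rw [e2, e3, e4, e6]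
    refine sum_congr rfl fun k _ => sum_congr rfl fun l _ => ?_
    simp only [hessDot]
    ring
  simp only [normRperp2, h.gInv_eq, mul_ite, mul_one, mul_zero, ite_mul, zero_mul,
    sum_ite_eq, mem_univ, if_true, one_mul]
  simp_rw [mul_sum, ← e]
  exact sum_sum_comm_sum_sum _

end IsGraphAt
end GraphQuantities

section MeanCurvatureJets

variable {m n : ℕ} {f : (Fin m → ℝ) → (Fin n → ℝ)} {x : Fin m → ℝ}

theorem pd_comm_eventually {u : (Fin m → ℝ) → ℝ} (hu : ContDiffAt ℝ ∞ u x) (i j : Fin m) :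
    pd (pd u i) j =ᶠ[𝓝 x] pd (pd u j) i :=
  (hu.eventually_of_infty 2).mono fun _ hy => pd_comm hy i j

theorem pd_four_comm {u : (Fin m → ℝ) → ℝ} (hu : ContDiffAt ℝ ∞ u x) (a b c d : Fin m) :
    pd (pd (pd (pd u a) b) c) d x = pd (pd (pd (pd u c) d) a) b x := by
  have hp : ∀ a, ContDiffAt ℝ ∞ (pd u a) x := hu.pd_infty
  have hpp : ∀ a b, ContDiffAt ℝ ∞ (pd (pd u a) b) x := fun a => (hp a).pd_infty
  calc pd (pd (pd (pd u a) b) c) d x = pd (pd (pd (pd u a) c) b) d x :=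
        pd_congr (pd_comm_eventually (hp a) b c) d
    _ = pd (pd (pd (pd u c) a) b) d x :=
        pd_congr ((pd_comm_eventually hu a c).pd b) d
    _ = pd (pd (pd (pd u c) a) d) b x := (pd_comm_eventually (hpp c a) b d).self_of_nhds
    _ = _ := pd_congr (pd_comm_eventually (hp c) a d) b

namespace IsGraphAt

variable (h : IsGraphAt f x)
include h

theorem pd_mcv (α : Fin n) (i : Fin m) : pd (mcv f α) i x = ∑ p, pd (sff f α p p) i x := by
  have h2 : ∀ p q, ContDiffAt ℝ ∞ (fun y => gInv f p q y * sff f α p q y) x := fun p q =>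
    (h.contDiffAt_gInv' p q).mul (h.contDiffAt_sff' α p q)
  have h1 := fun p => ContDiffAt.sum (s := univ) fun q _ => h2 p q
  show pd (fun y => ∑ p, ∑ q, gInv f p q y * sff f α p q y) i x = _
  rw [pd_sum fun p _ => (h1 p).diff_of_infty]
  refine sum_congr rfl fun p _ => ?_
  rw [pd_sum fun q _ => (h2 p q).diff_of_infty]
  simp_rw [fun q => pd_mul (h.contDiffAt_gInv' p q).diff_of_infty
    (h.contDiffAt_sff' α p q).diff_of_infty i, h.pd_gInv_eq, h.gInv_eq]
  simp

theorem pd_pd_mcv (α : Fin n) (i j : Fin m) : pd (pd (mcv f α) i) j x =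
    ∑ p, ∑ q, pd (pd (gInv f p q) i) j x * Fdd f α p q x + ∑ p, pd (pd (sff f α p p) i) j x := by
  have h2 : ∀ p q, ContDiffAt ℝ ∞ (fun y => gInv f p q y * sff f α p q y) x := fun p q =>
    (h.contDiffAt_gInv' p q).mul (h.contDiffAt_sff' α p q)
  have h1 := fun p => ContDiffAt.sum (s := univ) fun q _ => h2 p q
  show pd (pd (fun y => ∑ p, ∑ q, gInv f p q y * sff f α p q y) i) j x = _
  rw [pd_pd_sum fun p _ => h1 p, ← sum_add_distrib]
  refine sum_congr rfl fun p _ => ?_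
  rw [pd_pd_sum fun q _ => h2 p q]
  simp_rw [fun q => pd_pd_mul (h.contDiffAt_gInv' p q) (h.contDiffAt_sff' α p q) i j,
    h.pd_gInv_eq, h.gInv_eq, h.sff_eq_Fdd]
  simp [sum_add_distrib]

theorem pd_mcv_dot (i k : Fin m) :
    ∑ α, pd (mcv f α) i x * Fd f α k x = -∑ p, hessDot f x p p i k := by
  simp_rw [h.pd_mcv, sum_mul]
  rw [sum_comm, ← sum_neg_distrib]
  exact sum_congr rfl fun p _ => h.pd_sff_dot p p i k

theorem pd_pd_mcv_dot (i j : Fin m) :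
    ∑ α, pd (pd (mcv f α) j) i x * Fdd f α i j x =
      -∑ p, ∑ q, (hessDot f x j p i q + hessDot f x i p j q) * hessDot f x p q i j
      + ∑ p, (∑ α, pd (pd (Fdd f α i j) p) p x * Fdd f α i j x
        - ∑ k, (hessDot f x p p j k * hessDot f x i k i j
          + hessDot f x p p i k * hessDot f x j k i j)) := by
  conv_lhs => simp only [h.pd_pd_mcv, add_mul, sum_add_distrib, sum_mul]
  congr 1
  · rw [sum_comm, ← sum_neg_distrib]
    refine sum_congr rfl fun p _ => ?_
    rw [sum_comm, ← sum_neg_distrib]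
    refine sum_congr rfl fun q _ => ?_
    simp_rw [mul_assoc, ← mul_sum, h.pd_pd_gInv_eq, sum_add_distrib]
    simp only [hessDot]
    ring
  · rw [sum_comm]
    refine sum_congr rfl fun p _ => ?_
    have := h.pd_pd_sff_dot p p j i i j
    rw [this]
    congr 2
    funext α
    congr 1
    exact pd_four_comm (contDiffAt_pi.1 h.contDiffAt α) p p j i

end IsGraphAt

end MeanCurvatureJets

section TimeDerivatives

variable {m n : ℕ} {x : Fin m → ℝ} {t : ℝ}

theorem pd_eq_fderiv_uncurry {u : ℝ → (Fin m → ℝ) → ℝ} {s : ℝ} {y : Fin m → ℝ}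
    (hu : DifferentiableAt ℝ (fun p : ℝ × (Fin m → ℝ) => u p.1 p.2) (s, y)) (i : Fin m) :
    pd (u s) i y = fderiv ℝ (fun p : ℝ × (Fin m → ℝ) => u p.1 p.2) (s, y) (0, Pi.single i 1) := by
  have h1 : HasFDerivAt (fun z : Fin m → ℝ => (s, z)) (ContinuousLinearMap.inr ℝ ℝ (Fin m → ℝ)) y :=
    hasFDerivAt_prodMk_right s y
  have h2 := HasFDerivAt.comp y (f := fun z : Fin m → ℝ => (s, z)) hu.hasFDerivAt h1
  have h3 : HasFDerivAt (u s) _ y := h2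
  rw [pd, h3.fderiv]
  simp

theorem hasDerivAt_uncurry {u : ℝ → (Fin m → ℝ) → ℝ} {s : ℝ} {y : Fin m → ℝ}
    (hu : DifferentiableAt ℝ (fun p : ℝ × (Fin m → ℝ) => u p.1 p.2) (s, y)) :
    HasDerivAt (fun r => u r y)
      (fderiv ℝ (fun p : ℝ × (Fin m → ℝ) => u p.1 p.2) (s, y) (1, 0)) s := by
  have h1 : HasFDerivAt (fun r : ℝ => (r, y)) (ContinuousLinearMap.inl ℝ ℝ (Fin m → ℝ)) s :=
    hasFDerivAt_prodMk_left s y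
  have h2 := HasFDerivAt.comp s (f := fun r : ℝ => (r, y)) hu.hasFDerivAt h1
  exact h2.hasDerivAt

theorem eventually_contDiffAt_uncurry {E F : Type*} [NormedAddCommGroup E] [NormedSpace ℝ E]
    [NormedAddCommGroup F] [NormedSpace ℝ F] {w : ℝ × E → F} {x : E} {k : ℕ}
    (hw : ContDiffAt ℝ k w (t, x)) : ∀ᶠ y in 𝓝 x, ContDiffAt ℝ k w (t, y) :=
  (Continuous.prodMk_right t).continuousAt.eventually (hw.eventually (by simp))

theorem ContDiffAt.pd_uncurry {u : ℝ → (Fin m → ℝ) → ℝ} {k l : WithTop ℕ∞}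
    (hu : ContDiffAt ℝ l (fun p : ℝ × (Fin m → ℝ) => u p.1 p.2) (t, x)) (hkl : k + 1 ≤ l)
    (i : Fin m) : ContDiffAt ℝ k (fun p : ℝ × (Fin m → ℝ) => _root_.pd (u p.1) i p.2) (t, x) := by
  have h1 : ContDiffAt ℝ k (fun p : ℝ × (Fin m → ℝ) =>
      fderiv ℝ (fun p : ℝ × (Fin m → ℝ) => u p.1 p.2) p (0, Pi.single i 1)) (t, x) :=
    (hu.fderiv_right hkl).clm_apply contDiffAt_const
  refine h1.congr_of_eventuallyEq ?_
  have h2 : ContDiffAt ℝ 1 (fun p : ℝ × (Fin m → ℝ) => u p.1 p.2) (t, x) :=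
    hu.of_le (le_trans (by simp) hkl)
  filter_upwards [h2.eventually (by simp)] with p hp
  exact pd_eq_fderiv_uncurry (hp.differentiableAt (by simp)) i

/-- Time and space derivatives commute. -/
theorem hasDerivAt_pd {u : ℝ → (Fin m → ℝ) → ℝ}
    (hu : ContDiffAt ℝ 2 (fun p : ℝ × (Fin m → ℝ) => u p.1 p.2) (t, x)) (i : Fin m) :
    HasDerivAt (fun s => pd (u s) i x) (pd (fun y => deriv (fun s => u s y) t) i x) t := by
  set w := fun p : ℝ × (Fin m → ℝ) => u p.1 p.2 with hw
  have hd : DifferentiableAt ℝ (fderiv ℝ w) (t, x) :=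
    (hu.fderiv_right (m := 1) (by norm_num)).differentiableAt (by simp)
  have hev : ∀ᶠ p in 𝓝 (t, x), DifferentiableAt ℝ w p :=
    (hu.eventually (by simp)).mono fun p hp => hp.differentiableAt (by simp)
  have hevx : ∀ᶠ y in 𝓝 x, DifferentiableAt ℝ w (t, y) :=
    (Continuous.prodMk_right t).continuousAt.eventually hev
  have e1 : pd (fun y => deriv (fun s => u s y) t) i x
      = fderiv ℝ (fderiv ℝ w) (t, x) (0, Pi.single i 1) (1, 0) := by
    have : (fun y => deriv (fun s => u s y) t) =ᶠ[𝓝 x] fun y => fderiv ℝ w (t, y) (1, 0) := by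
      filter_upwards [hevx] with y hy using (hasDerivAt_uncurry hy).deriv
    rw [pd_congr this]
    have hd' : DifferentiableAt ℝ (fun p : ℝ × (Fin m → ℝ) => fderiv ℝ w p (1, 0)) (t, x) :=
      hd.clm_apply (differentiableAt_const _)
    have := pd_eq_fderiv_uncurry (u := fun s y => fderiv ℝ w (s, y) (1, 0)) hd' i
    rw [this, fderiv_clm_apply hd (differentiableAt_const _)]
    simp
  have hd' : DifferentiableAt ℝ (fun p : ℝ × (Fin m → ℝ) => pd (u p.1) i p.2) (t, x) :=
    (hu.pd_uncurry (k := 1) (by norm_num) i).differentiableAt (by simp)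
  have h1 := hasDerivAt_uncurry (u := fun s y => pd (u s) i y) hd'
  convert h1 using 1
  have : (fun p : ℝ × (Fin m → ℝ) => pd (u p.1) i p.2) =ᶠ[𝓝 (t, x)]
      fun p => fderiv ℝ w p (0, Pi.single i 1) := by
    filter_upwards [hev] with p hp using pd_eq_fderiv_uncurry hp i
  rw [this.fderiv_eq, fderiv_clm_apply hd (differentiableAt_const _), e1]
  simp only [fderiv_fun_const, Pi.zero_apply, ContinuousLinearMap.comp_zero, zero_add,
    ContinuousLinearMap.flip_apply]
  exact (hu.isSymmSndFDerivAt (by simp)).eq _ _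

end TimeDerivatives

section ReactionTerms

variable {ι : Type*} [Fintype ι] {B : ι → ι → ι → ι → ℝ}

/-- The algebraic identity between the reaction terms, for an array with the symmetries of
`⟨A_{ij}, A_{kl}⟩`. -/
theorem reaction_identity (hl : ∀ i j k l, B i j k l = B j i k l)
    (hr : ∀ i j k l, B i j k l = B i j l k) (hs : ∀ i j k l, B i j k l = B k l i j)
    (E D : ι → ι → ι → ℝ) :
    ∑ i, ∑ j, ∑ k, 2 * (∑ p, B p p i k) * B i j k j
      + ∑ i, ∑ j, ∑ k, 2 * (∑ p, B p p j k) * B i j i k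
      + 2 * ∑ i, ∑ j, (-∑ p, ∑ q, (B j p i q + B i p j q) * B p q i j
        + ∑ p, (E i j p - ∑ k, (B p p j k * B i k i j + B p p i k * B j k i j))) =
    ∑ p, (∑ i, ∑ j, (2 * E i j p + 2 * D i j p - 2 * ∑ k, B i j p k ^ 2)
        - 4 * ∑ i, ∑ j, ∑ k, B p i p k * B i j k j)
      - 2 * ∑ p, ∑ i, ∑ j, D i j p
      + 2 * ∑ i, ∑ j, ∑ k, ∑ l, B i j k l ^ 2
      + 2 * (2 * ∑ i, ∑ j, ∑ k, ∑ l, (B i k i l * B j k j l - B i k j l * B j k i l)) := by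
  obtain ⟨M, hM⟩ : ∃ M : ι → ι → ℝ, ∀ i k, M i k = ∑ j, B i j k j := ⟨_, fun _ _ => rfl⟩
  obtain ⟨H, hH⟩ : ∃ H : ι → ι → ℝ, ∀ i k, H i k = ∑ p, B p p i k := ⟨_, fun _ _ => rfl⟩
  have hM' : ∀ i k, ∑ j, B j i j k = M i k := fun i k => by
    rw [hM]
    exact sum_congr rfl fun j _ => by rw [hl, hr]
  have hMs : ∀ i k, M i k = M k i := fun i k => by
    rw [hM, hM]
    exact sum_congr rfl fun j _ => hs _ _ _ _
  have a1 : ∑ i, ∑ j, ∑ k, 2 * (∑ p, B p p i k) * B i j k j = 2 * ∑ i, ∑ k, H i k * M i k := by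
    rw [mul_sum]
    refine sum_congr rfl fun i _ => ?_
    rw [sum_comm, mul_sum]
    refine sum_congr rfl fun k _ => ?_
    rw [← mul_sum, ← hM, ← hH, mul_assoc]
  have a2 : ∑ i, ∑ j, ∑ k, 2 * (∑ p, B p p j k) * B i j i k = 2 * ∑ i, ∑ k, H i k * M i k := by
    rw [sum_comm, mul_sum]
    refine sum_congr rfl fun j _ => ?_
    rw [sum_comm, mul_sum]
    refine sum_congr rfl fun k _ => ?_
    rw [← mul_sum, hM', ← hH, mul_assoc]
  have a3 : ∑ i, ∑ j, ∑ p, ∑ k, B p p j k * B i k i j = ∑ i, ∑ k, H i k * M i k := by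
    rw [sum_comm]
    refine sum_congr rfl fun j _ => ?_
    simp_rw [sum_comm (f := fun p k => B p p j k * B _ k _ j), ← sum_mul, ← hH]
    rw [sum_comm]
    refine sum_congr rfl fun k _ => ?_
    rw [← mul_sum, hM', hMs]
  have a4 : ∑ i, ∑ j, ∑ p, ∑ k, B p p i k * B j k i j = ∑ i, ∑ k, H i k * M i k := by
    refine sum_congr rfl fun i _ => ?_
    simp_rw [sum_comm (f := fun p k => B p p i k * B _ k i _), ← sum_mul, ← hH]
    rw [sum_comm]
    refine sum_congr rfl fun k _ => ?_
    rw [← mul_sum, hMs i k, hM]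
    congr 1
    exact sum_congr rfl fun j _ => hl _ _ _ _
  have a5 : ∑ p, ∑ i, ∑ j, ∑ k, B p i p k * B i j k j = ∑ i, ∑ k, M i k * M i k := by
    simp_rw [sum_comm (f := fun j k => B _ _ _ k * B _ j k j), ← mul_sum, ← hM]
    rw [sum_comm]
    refine sum_congr rfl fun i _ => ?_
    rw [sum_comm]
    exact sum_congr rfl fun k _ => by rw [← sum_mul, hM']
  have a6 : ∑ i, ∑ j, ∑ k, ∑ l, B i k i l * B j k j l = ∑ i, ∑ k, M i k * M i k := by
    rw [sum_sum_comm_sum_sum]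
    refine sum_congr rfl fun k _ => sum_congr rfl fun l _ => ?_
    rw [← hM', sum_mul_sum]
  have a7 : ∑ i, ∑ j, ∑ p, ∑ q, B i p j q * B p q i j
      = ∑ i, ∑ j, ∑ p, ∑ q, B j p i q * B p q i j := by
    rw [sum_comm]
    refine sum_congr rfl fun j _ => sum_congr rfl fun i _ => sum_congr rfl fun p _ =>
      sum_congr rfl fun q _ => by rw [hr p q]
  have a8 : ∑ i, ∑ j, ∑ k, ∑ l, B i k j l * B j k i l
      = ∑ i, ∑ j, ∑ p, ∑ q, B j p i q * B p q i j := by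
    rw [sum_comm (f := fun l i => ∑ k, ∑ j, B i k l j * B k j l i)]
    refine sum_congr rfl fun i _ => ?_
    rw [sum_comm, sum_comm (f := fun l k => ∑ j, B i k l j * B k j l i)]
    refine sum_congr rfl fun k _ => ?_
    rw [sum_comm]
    refine sum_congr rfl fun l _ => sum_congr rfl fun j _ => ?_
    rw [hr i k, hl j, hr k j]
  have a9 : ∑ p, ∑ i, ∑ j, ∑ k, B i j p k ^ 2 = ∑ i, ∑ j, ∑ k, ∑ l, B i j k l ^ 2 := by
    rw [sum_comm]
    exact sum_congr rfl fun i _ => sum_comm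
  have a10 : ∑ i, ∑ j, ∑ p, E i j p = ∑ p, ∑ i, ∑ j, E i j p := by
    rw [sum_comm (f := fun p i => ∑ j, E i j p)]
    exact sum_congr rfl fun i _ => sum_comm
  simp only [add_mul, sum_add_distrib, sum_sub_distrib, sum_neg_distrib, ← mul_sum]
  rw [a1, a2, a3, a4, a5, a6, a7, a8, a9, a10]
  ring

end ReactionTerms

section GraphEvolution

variable {m n : ℕ} {X : ℝ → (Fin m → ℝ) → (Fin n → ℝ)} {t : ℝ} {x : Fin m → ℝ}

theorem contDiffAt_Fd_uncurry (hX : ContDiffAt ℝ ∞ (fun p : ℝ × (Fin m → ℝ) => X p.1 p.2) (t, x))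
    (α : Fin n) (i : Fin m) :
    ContDiffAt ℝ ∞ (fun p : ℝ × (Fin m → ℝ) => Fd (X p.1) α i p.2) (t, x) :=
  ContDiffAt.pd_uncurry (u := fun s y => X s y α) (contDiffAt_pi.1 hX α) (by simp) i

theorem ContDiffAt.time {u : ℝ → (Fin m → ℝ) → ℝ}
    (hu : ContDiffAt ℝ ∞ (fun p : ℝ × (Fin m → ℝ) => u p.1 p.2) (t, x)) :
    ContDiffAt ℝ ∞ (fun s => u s x) t :=
  ContDiffAt.comp t (g := fun p : ℝ × (Fin m → ℝ) => u p.1 p.2) (f := fun s : ℝ => (s, x)) hu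
    (contDiffAt_id.prodMk contDiffAt_const)

theorem contDiffAt_gInd_time
    (hX : ContDiffAt ℝ ∞ (fun p : ℝ × (Fin m → ℝ) => X p.1 p.2) (t, x)) (i j : Fin m) :
    ContDiffAt ℝ ∞ (fun s => gInd (X s) i j x) t :=
  ContDiffAt.sum fun α _ => (ContDiffAt.time (u := fun s y => Fd (X s) α i y)
    (contDiffAt_Fd_uncurry hX α i)).mul (ContDiffAt.time (u := fun s y => Fd (X s) α j y)
    (contDiffAt_Fd_uncurry hX α j))

theorem eventually_det_ne_zero_time
    (hX : ContDiffAt ℝ ∞ (fun p : ℝ × (Fin m → ℝ) => X p.1 p.2) (t, x))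
    (hdet : (gMat (X t) x).det ≠ 0) : ∀ᶠ s in 𝓝 t, (gMat (X s) x).det ≠ 0 := by
  have hc : ContinuousAt (fun s => gMat (X s) x) t := by
    refine tendsto_pi_nhds.2 fun i => tendsto_pi_nhds.2 fun j => ?_
    exact (contDiffAt_gInd_time hX i j).continuousAt
  exact (Continuous.matrix_det continuous_id).continuousAt.comp hc |>.eventually_ne hdet

theorem eventually_contDiffAt_two_time
    (hX : ContDiffAt ℝ ∞ (fun p : ℝ × (Fin m → ℝ) => X p.1 p.2) (t, x)) :
    ∀ᶠ s in 𝓝 t, ContDiffAt ℝ 2 (X s) x := by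
  have h : ∀ᶠ s in 𝓝 t, ContDiffAt ℝ 2 (fun p : ℝ × (Fin m → ℝ) => X p.1 p.2) (s, x) :=
    (Continuous.prodMk_left x).continuousAt.eventually (hX.eventually_of_infty 2)
  refine h.mono fun s hs => ?_
  exact ContDiffAt.comp x (g := fun p : ℝ × (Fin m → ℝ) => X p.1 p.2) (f := fun y => (s, y)) hs
    (contDiffAt_const.prodMk contDiffAt_id)

namespace IsGraphAt

/-- Evolution of `|A|²` in coordinates that are graphical at the given time. -/
theorem deriv_normA2 (h : IsGraphAt (X t) x)
    (hX : ContDiffAt ℝ ∞ (fun p : ℝ × (Fin m → ℝ) => X p.1 p.2) (t, x))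
    (hflow : ∀ᶠ y in 𝓝 x, ∀ α, deriv (fun s => X s y α) t = mcv (X t) α y) :
    deriv (fun s => normA2 (X s) x) t =
      lapBel (X t) (normA2 (X t)) x - 2 * normNperpA2 (X t) x
        + 2 * normSsf2 (X t) x + 2 * normRperp2 (X t) x := by
  have hXα := fun α => contDiffAt_pi.1 hX α
  have hX2 := fun α => ((hXα α).eventually_of_infty 2).self_of_nhds
  have hFd : ∀ α i, HasDerivAt (fun s => Fd (X s) α i x) (pd (mcv (X t) α) i x) t := by
    intro α i
    rw [← pd_congr (hflow.mono fun y hy => hy α) i]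
    exact hasDerivAt_pd (u := fun s y => X s y α) (hX2 α) i
  have hFdd : ∀ α i j, HasDerivAt (fun s => Fdd (X s) α i j x)
      (pd (pd (mcv (X t) α) j) i x) t := by
    intro α i j
    have h1 : (fun y => deriv (fun s => Fd (X s) α j y) t) =ᶠ[𝓝 x] pd (mcv (X t) α) j := by
      filter_upwards [hflow.eventually_nhds, eventually_contDiffAt_uncurry (k := 2)
        (hX2 α)] with y hy h2
      rw [← pd_congr (hy.mono fun z hz => hz α) j]
      exact (hasDerivAt_pd (u := fun s y => X s y α) h2 j).deriv
    rw [← pd_congr h1 i]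
    exact hasDerivAt_pd (u := fun s y => Fd (X s) α j y)
      ((contDiffAt_Fd_uncurry hX α j).eventually_of_infty 2).self_of_nhds i
  have hgInd : ∀ i j, HasDerivAt (fun s => gInd (X s) i j x)
      (-2 * ∑ p, hessDot (X t) x p p i j) t := by
    intro i j
    have h1 := HasDerivAt.fun_sum (u := univ) fun α _ => (hFd α i).mul (hFd α j)
    refine h1.congr_deriv ?_
    rw [sum_add_distrib]
    simp_rw [mul_comm (Fd (X t) _ i x)]
    rw [h.pd_mcv_dot i j, h.pd_mcv_dot j i, sum_congr rfl fun p _ => h.hessDot_right p p j i]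
    ring
  have hgInv : ∀ i j, HasDerivAt (fun s => gInv (X s) i j x)
      (2 * ∑ p, hessDot (X t) x p p i j) t := by
    have hd : ∀ i j, DifferentiableAt ℝ (fun s => gInv (X s) i j x) t := fun i j =>
      (contDiffAt_matrix_inv (M := fun s => gMat (X s) x) (fun i j => contDiffAt_gInd_time hX i j)
        h.det_ne_zero i j).diff_of_infty
    intro i j
    have h1 := HasDerivAt.fun_sum (u := univ) fun k _ => (hd i k).hasDerivAt.mul (hgInd k j)
    have h2 : (fun s => ∑ k, gInv (X s) i k x * gInd (X s) k j x) =ᶠ[𝓝 t]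
        fun _ => if i = j then 1 else 0 :=
      (eventually_det_ne_zero_time hX h.det_ne_zero).mono fun s hs => gInv_mul_gInd hs i j
    have h3 := h1.unique
      ((hasDerivAt_const t (if i = j then (1 : ℝ) else 0)).congr_of_eventuallyEq h2)
    simp_rw [h.gInd_eq, h.gInv_eq, sum_add_distrib] at h3
    simp only [mul_ite, mul_one, mul_zero, sum_ite_eq', mem_univ, if_true, ite_mul, one_mul,
      zero_mul, sum_ite_eq] at h3
    have h4 : deriv (fun s => gInv (X s) i j x) t = 2 * ∑ p, hessDot (X t) x p p i j := by
      linarith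
    rw [← h4]
    exact (hd i j).hasDerivAt
  have hchr : ∀ k i j, DifferentiableAt ℝ (fun s => chr (X s) k i j x) t := by
    intro k i j
    have h1 : (fun s => chr (X s) k i j x) =ᶠ[𝓝 t] fun s =>
        ∑ l, gInv (X s) k l x * ∑ α, Fdd (X s) α i j x * Fd (X s) α l x :=
      (eventually_contDiffAt_two_time hX).mono fun s hs => chr_eq hs k i j
    refine DifferentiableAt.congr_of_eventuallyEq ?_ h1
    refine DifferentiableAt.fun_sum fun l _ => (hgInv k l).differentiableAt.mul ?_
    exact DifferentiableAt.fun_sum fun α _ =>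
      (hFdd α i j).differentiableAt.mul (hFd α l).differentiableAt
  obtain ⟨c, hc⟩ : ∃ c : Fin m → Fin m → Fin m → ℝ, ∀ k i j,
      HasDerivAt (fun s => chr (X s) k i j x) (c k i j) t :=
    ⟨_, fun k i j => (hchr k i j).hasDerivAt⟩
  have hsff : ∀ α i j, HasDerivAt (fun s => sff (X s) α i j x)
      (pd (pd (mcv (X t) α) j) i x - ∑ k, c k i j * Fd (X t) α k x) t := by
    intro α i j
    have h1 := (hFdd α i j).sub (HasDerivAt.fun_sum (u := univ) fun k _ => (hc k i j).mul (hFd α k))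
    refine h1.congr_deriv ?_
    simp_rw [h.chr_eq_zero]
    simp
  have hnorm := HasDerivAt.fun_sum (u := univ) fun i _ => HasDerivAt.fun_sum (u := univ) fun j _ =>
      HasDerivAt.fun_sum (u := univ) fun k _ => HasDerivAt.fun_sum (u := univ) fun l _ =>
        ((hgInv i k).fun_mul (hgInv j l)).fun_mul
          (HasDerivAt.fun_sum (u := univ) fun α _ => (hsff α i j).fun_mul (hsff α k l))
  have hnorm_eq : (fun s => normA2 (X s) x) = fun s => ∑ i, ∑ j, ∑ k, ∑ l,
      (gInv (X s) i k x * gInv (X s) j l x) * ∑ α, sff (X s) α i j x * sff (X s) α k l x :=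
    funext fun s => congrFun normA2_eq x
  have hdot : ∀ i j, ∑ α, ((pd (pd (mcv (X t) α) j) i x - ∑ k, c k i j * Fd (X t) α k x)
        * Fdd (X t) α i j x + Fdd (X t) α i j x *
        (pd (pd (mcv (X t) α) j) i x - ∑ k, c k i j * Fd (X t) α k x))
      = 2 * ∑ α, pd (pd (mcv (X t) α) j) i x * Fdd (X t) α i j x := by
    intro i j
    have e : ∑ α, (∑ k, c k i j * Fd (X t) α k x) * Fdd (X t) α i j x = 0 := by
      simp_rw [sum_mul]
      rw [sum_comm]
      simp_rw [mul_assoc, ← mul_sum, h.Fd_dot_Fdd]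
      simp
    calc _ = 2 * ∑ α, pd (pd (mcv (X t) α) j) i x * Fdd (X t) α i j x
          - 2 * ∑ α, (∑ k, c k i j * Fd (X t) α k x) * Fdd (X t) α i j x := by
          rw [mul_sum, mul_sum, ← sum_sub_distrib]
          exact sum_congr rfl fun α _ => by ring
      _ = _ := by rw [e]; ring
  have hD0 : ∀ i j k l, ∑ α, Fdd (X t) α i j x * Fdd (X t) α k l x = hessDot (X t) x i j k l :=
    fun _ _ _ _ => rfl
  rw [hnorm_eq, hnorm.deriv, h.lapBel_eq, h.normNperpA2_eq, h.normSsf2_eq, h.normRperp2_eq]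
  simp_rw [h.pd_pd_normA2]
  rw [← reaction_identity h.hessDot_left h.hessDot_right (hessDot_swap (f := X t) (x := x))
    (fun i j p => ∑ α, pd (pd (Fdd (X t) α i j) p) p x * Fdd (X t) α i j x)
    (fun i j p => ∑ α, pd (Fdd (X t) α i j) p x * pd (Fdd (X t) α i j) p x)]
  simp_rw [← h.pd_pd_mcv_dot, h.sff_eq_Fdd, h.gInv_eq, hD0]
  simp only [mul_ite, mul_one, mul_zero, ite_mul, one_mul, zero_mul, add_mul, sum_add_distrib,
    sum_ite_eq, mem_univ, if_true]
  congr 1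
  · congr 1
    refine sum_congr rfl fun i _ => sum_congr rfl fun j _ => ?_
    rw [sum_comm]
    simp only [sum_ite_eq, mem_univ, if_true]
  · simp_rw [← sum_add_distrib, hdot, mul_sum]

end IsGraphAt
end GraphEvolution

section Contraction

variable {ι : Type*} [Fintype ι] {G G' J : ι → ι → ℝ}

theorem sum_contract_two (hG : ∀ a b, ∑ i, ∑ j, G' i j * J a i * J b j = G a b)
    (T : ι → ι → ℝ) :
    ∑ i, ∑ j, G' i j * ∑ a, ∑ b, T a b * J a i * J b j = ∑ a, ∑ b, G a b * T a b := by
  simp_rw [mul_sum]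
  rw [sum_sum_comm_sum_sum]
  refine sum_congr rfl fun a _ => sum_congr rfl fun b _ => ?_
  rw [← hG, sum_mul]
  refine sum_congr rfl fun i _ => ?_
  rw [sum_mul]
  exact sum_congr rfl fun j _ => by ring

theorem sum_contract_mul (hG : ∀ a b, ∑ i, ∑ j, G' i j * J a i * J b j = G a b)
    (u v : ι → ℝ) :
    ∑ i, ∑ j, G' i j * (∑ a, u a * J a i) * (∑ b, v b * J b j) =
      ∑ a, ∑ b, G a b * u a * v b := by
  simp_rw [mul_assoc (G _ _), ← sum_contract_two hG (fun a b => u a * v b), mul_assoc (G' _ _),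
    sum_mul_sum]
  refine sum_congr rfl fun i _ => sum_congr rfl fun j _ => ?_
  congr 1
  exact sum_congr rfl fun a _ => sum_congr rfl fun b _ => by ring

theorem sum_contract_four (hG : ∀ a b, ∑ i, ∑ j, G' i j * J a i * J b j = G a b)
    (A B : ι → ι → ℝ) :
    ∑ i, ∑ j, ∑ k, ∑ l, G' i k * G' j l * (∑ a, ∑ b, A a b * J a i * J b j)
        * (∑ a, ∑ b, B a b * J a k * J b l) =
      ∑ i, ∑ j, ∑ k, ∑ l, G i k * G j l * A i j * B k l := by
  have h1 : ∀ (A : ι → ι → ℝ) i j, ∑ a, ∑ b, A a b * J a i * J b j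
      = ∑ b, (∑ a, A a b * J a i) * J b j := fun A i j => by
    rw [sum_comm]
    exact sum_congr rfl fun b _ => (sum_mul _ _ _).symm
  calc _ = ∑ i, ∑ k, G' i k * ∑ j, ∑ l, G' j l * (∑ b, (∑ a, A a b * J a i) * J b j)
        * (∑ b, (∑ a, B a b * J a k) * J b l) := by
        refine sum_congr rfl fun i _ => ?_
        rw [sum_comm]
        refine sum_congr rfl fun k _ => ?_
        rw [mul_sum]
        refine sum_congr rfl fun j _ => ?_
        rw [mul_sum]
        refine sum_congr rfl fun l _ => ?_
        rw [h1, h1]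
        ring
    _ = ∑ i, ∑ k, ∑ j, ∑ l, G j l * (G' i k * (∑ a, A a j * J a i) * ∑ a, B a l * J a k) := by
        refine sum_congr rfl fun i _ => sum_congr rfl fun k _ => ?_
        rw [sum_contract_mul hG, mul_sum]
        refine sum_congr rfl fun j _ => ?_
        rw [mul_sum]
        exact sum_congr rfl fun l _ => by ring
    _ = ∑ j, ∑ l, G j l * ∑ i, ∑ k, G i k * A i j * B k l := by
        rw [sum_sum_comm_sum_sum]
        refine sum_congr rfl fun j _ => sum_congr rfl fun l _ => ?_
        simp_rw [← mul_sum]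
        rw [sum_contract_mul hG (fun a => A a j) (fun a => B a l)]
    _ = _ := by
        simp_rw [mul_sum]
        rw [sum_sum_comm_sum_sum]
        refine sum_congr rfl fun i _ => ?_
        rw [sum_comm]
        refine sum_congr rfl fun j _ => sum_congr rfl fun k _ => sum_congr rfl fun l _ => ?_
        ring

end Contraction

section Reparametrization

variable {m n : ℕ} {f : (Fin m → ℝ) → (Fin n → ℝ)} {φ : (Fin m → ℝ) → (Fin m → ℝ)}
  {y : Fin m → ℝ}

/-- Jacobian entries of a change of coordinates. -/
def jac (φ : (Fin m → ℝ) → (Fin m → ℝ)) (a i : Fin m) (y : Fin m → ℝ) : ℝ :=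
  pd (fun z => φ z a) i y

theorem ContDiffAt.jac {k l : WithTop ℕ∞} (hφ : ContDiffAt ℝ l φ y) (hkl : k + 1 ≤ l)
    (a i : Fin m) : ContDiffAt ℝ k (_root_.jac φ a i) y :=
  (contDiffAt_pi.1 hφ a).pd hkl i

theorem pd_jac_symm (hφ : ContDiffAt ℝ 2 φ y) (a i j : Fin m) :
    pd (jac φ a i) j y = pd (jac φ a j) i y :=
  pd_comm (contDiffAt_pi.1 hφ a) i j

theorem pd_pd_comp {u : (Fin m → ℝ) → ℝ} (hu : ContDiffAt ℝ 2 u (φ y))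
    (hφ : ContDiffAt ℝ 2 φ y) (i j : Fin m) :
    pd (pd (fun z => u (φ z)) j) i y =
      ∑ a, ∑ b, pd (pd u b) a (φ y) * jac φ a i y * jac φ b j y
        + ∑ a, pd u a (φ y) * pd (jac φ a j) i y := by
  have h1 : pd (fun z => u (φ z)) j =ᶠ[𝓝 y] fun z => ∑ b, pd u b (φ z) * jac φ b j z := by
    filter_upwards [hφ.continuousAt.eventually (hu.eventually (by simp)),
      hφ.eventually (by simp)] with z hz hz'
    exact pd_comp (hz.differentiableAt (by simp)) (hz'.differentiableAt (by simp)) j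
  have hφ' := hφ.differentiableAt (by simp)
  have hu' : ∀ b, DifferentiableAt ℝ (pd u b) (φ y) := fun b =>
    (hu.pd (k := 1) (by norm_num) b).differentiableAt (by simp)
  have hc : ∀ b, DifferentiableAt ℝ (fun z => pd u b (φ z)) y := fun b =>
    DifferentiableAt.comp y (hu' b) hφ'
  have hj : ∀ b, DifferentiableAt ℝ (jac φ b j) y := fun b =>
    (hφ.jac (k := 1) (by norm_num) b j).differentiableAt (by simp)
  rw [pd_congr h1, pd_sum fun b _ => (hc b).fun_mul (hj b)]
  simp_rw [fun b => pd_mul (hc b) (hj b) i, sum_add_distrib, fun b => pd_comp (hu' b) hφ' i]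
  rw [sum_comm (f := fun a b => pd (pd u b) a (φ y) * jac φ a i y * jac φ b j y)]
  congr 1
  exact sum_congr rfl fun b _ => sum_mul _ _ _

theorem Fd_comp (hf : DifferentiableAt ℝ f (φ y)) (hφ : DifferentiableAt ℝ φ y) (α : Fin n)
    (i : Fin m) : Fd (f ∘ φ) α i y = ∑ a, Fd f α a (φ y) * jac φ a i y :=
  pd_comp (f := fun z => f z α) (differentiableAt_pi.1 hf α) hφ i

theorem Fdd_comp (hf : ContDiffAt ℝ 2 f (φ y)) (hφ : ContDiffAt ℝ 2 φ y) (α : Fin n)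
    (i j : Fin m) : Fdd (f ∘ φ) α i j y =
      ∑ a, ∑ b, Fdd f α a b (φ y) * jac φ a i y * jac φ b j y
        + ∑ a, Fd f α a (φ y) * pd (jac φ a j) i y :=
  pd_pd_comp (u := fun z => f z α) (contDiffAt_pi.1 hf α) hφ i j

theorem gMat_comp (hf : DifferentiableAt ℝ f (φ y)) (hφ : DifferentiableAt ℝ φ y) :
    gMat (f ∘ φ) y =
      (Matrix.of fun a i => jac φ a i y).transpose * gMat f (φ y)
        * Matrix.of fun a i => jac φ a i y := by
  ext i j
  simp only [gMat, gInd, Fd_comp hf hφ, Matrix.mul_apply, Matrix.transpose_apply, Matrix.of_apply,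
    sum_mul, mul_sum]
  rw [sum_comm]
  refine sum_congr rfl fun a _ => ?_
  rw [sum_comm]
  exact sum_congr rfl fun b _ => sum_congr rfl fun α _ => by ring

theorem det_gMat_ne_zero_of_comp (hf : DifferentiableAt ℝ f (φ y)) (hφ : DifferentiableAt ℝ φ y)
    (hdet : (gMat (f ∘ φ) y).det ≠ 0) : (gMat f (φ y)).det ≠ 0 := by
  rw [gMat_comp hf hφ, Matrix.det_mul, Matrix.det_mul] at hdet
  exact right_ne_zero_of_mul (left_ne_zero_of_mul hdet)

theorem sum_gInv_comp (hf : DifferentiableAt ℝ f (φ y)) (hφ : DifferentiableAt ℝ φ y)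
    (hdet : (gMat (f ∘ φ) y).det ≠ 0) (a b : Fin m) :
    ∑ i, ∑ j, gInv (f ∘ φ) i j y * jac φ a i y * jac φ b j y = gInv f a b (φ y) := by
  obtain ⟨M, hM⟩ : ∃ M : Matrix (Fin m) (Fin m) ℝ, M = Matrix.of fun a i => jac φ a i y := ⟨_, rfl⟩
  have h1 : M.det ≠ 0 := by
    rw [gMat_comp hf hφ, Matrix.det_mul] at hdet
    rw [hM]
    exact right_ne_zero_of_mul hdet
  have hu : IsUnit M.det := isUnit_iff_ne_zero.2 h1
  have hu' : IsUnit M.transpose.det := by rwa [Matrix.det_transpose]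
  have h2 : M * (gMat (f ∘ φ) y)⁻¹ * M.transpose = (gMat f (φ y))⁻¹ := by
    rw [gMat_comp hf hφ, ← hM, Matrix.mul_inv_rev, Matrix.mul_inv_rev, Matrix.mul_assoc,
      Matrix.mul_assoc, Matrix.mul_assoc, Matrix.nonsing_inv_mul _ hu', Matrix.mul_one,
      ← Matrix.mul_assoc, Matrix.mul_nonsing_inv _ hu, Matrix.one_mul]
  have h3 := congrFun (congrFun h2 a) b
  simp only [hM, Matrix.mul_apply, Matrix.transpose_apply, Matrix.of_apply, sum_mul] at h3
  rw [gInv, ← h3, sum_comm]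
  refine sum_congr rfl fun i _ => sum_congr rfl fun j _ => ?_
  rw [gInv]
  ring

end Reparametrization

section ReparametrizationInvariance

variable {m n : ℕ} {f : (Fin m → ℝ) → (Fin n → ℝ)} {φ : (Fin m → ℝ) → (Fin m → ℝ)}
  {y : Fin m → ℝ}

theorem sum_norP_mul_Fd (hdet : (gMat f y).det ≠ 0) (α : Fin n) (k : Fin m) :
    ∑ β, norP f α β y * Fd f β k y = 0 := by
  have e : ∑ β, tanP f α β y * Fd f β k y = Fd f α k y := by
    calc _ = ∑ i, (∑ j, gInv f i j y * gInd f j k y) * Fd f α i y := by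
          simp only [tanP, gInd, sum_mul, mul_sum]
          rw [sum_comm]
          refine sum_congr rfl fun i _ => ?_
          rw [sum_comm]
          exact sum_congr rfl fun j _ => sum_congr rfl fun β _ => by ring
      _ = _ := by simp [gInv_mul_gInd hdet]
  simp_rw [norP, sub_mul, sum_sub_distrib, e]
  simp

/-- The point `y` is a regular point of the reparametrization `f ∘ φ`. -/
structure IsReparamAt (f : (Fin m → ℝ) → (Fin n → ℝ)) (φ : (Fin m → ℝ) → (Fin m → ℝ))
    (y : Fin m → ℝ) : Prop where
  contDiffAt_two : ContDiffAt ℝ 2 f (φ y)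
  contDiffAt_coord : ContDiffAt ℝ 2 φ y
  det_ne_zero : (gMat (f ∘ φ) y).det ≠ 0

theorem eventually_isReparamAt (hf : ContDiffAt ℝ ∞ f (φ y)) (hφ : ContDiffAt ℝ ∞ φ y)
    (hdet : (gMat (f ∘ φ) y).det ≠ 0) : ∀ᶠ z in 𝓝 y, IsReparamAt f φ z := by
  have h1 : ContDiffAt ℝ 1 (f ∘ φ) y :=
    ((hf.comp y hφ).eventually_of_infty 1).self_of_nhds
  filter_upwards [hφ.continuousAt.eventually (hf.eventually_of_infty 2),
    hφ.eventually_of_infty 2, eventually_det_ne_zero h1 hdet] with z h2 h3 h4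
  exact ⟨h2, h3, h4⟩

theorem ssf_eq_sum (α β : Fin n) : ssf f α β y =
    ∑ i, ∑ j, ∑ k, ∑ l, gInv f i k y * gInv f j l y * sff f α k j y * sff f β l i y := by
  simp_rw [ssf, sum_mul_sum]
  exact sum_congr rfl fun i _ => sum_congr rfl fun j _ => sum_congr rfl fun k _ =>
    sum_congr rfl fun l _ => by ring

namespace IsReparamAt

variable (h : IsReparamAt f φ y)
include h

theorem differentiableAt : DifferentiableAt ℝ f (φ y) :=
  h.contDiffAt_two.differentiableAt (by simp)

theorem differentiableAt_coord : DifferentiableAt ℝ φ y :=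
  h.contDiffAt_coord.differentiableAt (by simp)

theorem det_ne_zero' : (gMat f (φ y)).det ≠ 0 :=
  det_gMat_ne_zero_of_comp h.differentiableAt h.differentiableAt_coord h.det_ne_zero

theorem sum_gInv (a b : Fin m) :
    ∑ i, ∑ j, gInv (f ∘ φ) i j y * jac φ a i y * jac φ b j y = gInv f a b (φ y) :=
  sum_gInv_comp h.differentiableAt h.differentiableAt_coord h.det_ne_zero a b

theorem Fd_eq (α : Fin n) (i : Fin m) :
    Fd (f ∘ φ) α i y = ∑ a, Fd f α a (φ y) * jac φ a i y :=
  Fd_comp h.differentiableAt h.differentiableAt_coord α i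

theorem norP_eq (α β : Fin n) : norP (f ∘ φ) α β y = norP f α β (φ y) := by
  simp_rw [norP, tanP, h.Fd_eq, sum_contract_mul (J := fun a i => jac φ a i y) h.sum_gInv]

theorem sff_eq (α : Fin n) (i j : Fin m) : sff (f ∘ φ) α i j y =
    ∑ a, ∑ b, sff f α a b (φ y) * jac φ a i y * jac φ b j y := by
  have hc : ContDiffAt ℝ 2 (f ∘ φ) y := h.contDiffAt_two.comp y h.contDiffAt_coord
  have e : ∑ β, norP f α β (φ y) * ∑ a, Fd f β a (φ y) * pd (jac φ a j) i y = 0 := by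
    simp_rw [mul_sum]
    rw [sum_comm]
    simp_rw [← mul_assoc, ← sum_mul, sum_norP_mul_Fd h.det_ne_zero']
    simp
  rw [sff_eq_norP hc]
  simp_rw [Fdd_comp h.contDiffAt_two h.contDiffAt_coord, h.norP_eq, mul_add, sum_add_distrib]
  rw [e, add_zero]
  simp_rw [mul_sum]
  rw [sum_comm]
  refine sum_congr rfl fun a _ => ?_
  rw [sum_comm]
  refine sum_congr rfl fun b _ => ?_
  simp_rw [sff_eq_norP h.contDiffAt_two, sum_mul]
  exact sum_congr rfl fun β _ => by ring

theorem mcv_eq (α : Fin n) : mcv (f ∘ φ) α y = mcv f α (φ y) := by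
  simp_rw [mcv, h.sff_eq, sum_contract_two (J := fun a i => jac φ a i y) h.sum_gInv]

theorem normA2_eq : normA2 (f ∘ φ) y = normA2 f (φ y) := by
  simp_rw [normA2, h.sff_eq, sum_contract_four (J := fun a i => jac φ a i y) h.sum_gInv]

theorem ssf_eq (α β : Fin n) : ssf (f ∘ φ) α β y = ssf f α β (φ y) := by
  have key : ∀ (g : (Fin m → ℝ) → (Fin n → ℝ)) z, ContDiffAt ℝ 2 g z → ssf g α β z =
      ∑ i, ∑ j, ∑ k, ∑ l, gInv g i k z * gInv g j l z * sff g α i j z * sff g β k l z := by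
    intro g z hg
    rw [ssf_eq_sum, sum_comm, sum_comm (f := fun i j => ∑ k, ∑ l,
      gInv g i k z * gInv g j l z * sff g α i j z * sff g β k l z)]
    refine sum_congr rfl fun j _ => ?_
    rw [sum_comm]
    refine sum_congr rfl fun i _ => sum_congr rfl fun k _ => sum_congr rfl fun l _ => ?_
    rw [gInv_symm k i, sff_symm hg β l k]
  rw [key _ _ (h.contDiffAt_two.comp y h.contDiffAt_coord), key _ _ h.contDiffAt_two]
  simp_rw [h.sff_eq, sum_contract_four (J := fun a i => jac φ a i y) h.sum_gInv]

theorem normSsf2_eq : normSsf2 (f ∘ φ) y = normSsf2 f (φ y) := by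
  simp_rw [normSsf2, h.ssf_eq]

theorem sum_jac_mul_chr (a i j : Fin m) : ∑ k, jac φ a k y * chr (f ∘ φ) k i j y =
    ∑ c, ∑ d, chr f a c d (φ y) * jac φ c i y * jac φ d j y + pd (jac φ a j) i y := by
  have hc : ContDiffAt ℝ 2 (f ∘ φ) y := h.contDiffAt_two.comp y h.contDiffAt_coord
  have e1 : ∑ k, jac φ a k y * chr (f ∘ φ) k i j y =
      ∑ b, gInv f a b (φ y) * ∑ α, Fdd (f ∘ φ) α i j y * Fd f α b (φ y) := by
    have e : ∀ l, ∑ α, Fdd (f ∘ φ) α i j y * Fd (f ∘ φ) α l y =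
        ∑ b, (∑ α, Fdd (f ∘ φ) α i j y * Fd f α b (φ y)) * jac φ b l y := by
      intro l
      simp_rw [h.Fd_eq, mul_sum, sum_mul]
      rw [sum_comm]
      exact sum_congr rfl fun b _ => sum_congr rfl fun α _ => by ring
    simp_rw [chr_eq hc, e, ← h.sum_gInv a, mul_sum (s := (univ : Finset (Fin m)))]
    simp_rw [sum_mul (s := (univ : Finset (Fin m)))]
    rw [sum_comm (f := fun b k => ∑ l, gInv (f ∘ φ) k l y * jac φ a k y * jac φ b l y
      * ∑ α, Fdd (f ∘ φ) α i j y * Fd f α b (φ y))]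
    refine sum_congr rfl fun k _ => ?_
    rw [sum_comm]
    exact sum_congr rfl fun b _ => sum_congr rfl fun l _ => by ring
  have e2 : ∀ b, ∑ α, Fdd (f ∘ φ) α i j y * Fd f α b (φ y) =
      ∑ c, ∑ d, (∑ α, Fdd f α c d (φ y) * Fd f α b (φ y)) * jac φ c i y * jac φ d j y
        + ∑ e, pd (jac φ e j) i y * gInd f b e (φ y) := by
    intro b
    simp_rw [Fdd_comp h.contDiffAt_two h.contDiffAt_coord, add_mul, sum_add_distrib, gInd, sum_mul,
      mul_sum]
    congr 1
    · rw [sum_comm]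
      refine sum_congr rfl fun c _ => ?_
      rw [sum_comm]
      exact sum_congr rfl fun d _ => sum_congr rfl fun α _ => by ring
    · rw [sum_comm]
      exact sum_congr rfl fun e _ => sum_congr rfl fun α _ => by ring
  have e3 : ∑ b, gInv f a b (φ y) * ∑ e, pd (jac φ e j) i y * gInd f b e (φ y)
      = pd (jac φ a j) i y := by
    calc _ = ∑ e, (∑ b, gInv f a b (φ y) * gInd f b e (φ y)) * pd (jac φ e j) i y := by
          simp_rw [mul_sum, sum_mul]
          rw [sum_comm]
          exact sum_congr rfl fun e _ => sum_congr rfl fun b _ => by ring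
      _ = _ := by simp [gInv_mul_gInd h.det_ne_zero']
  rw [e1]
  simp_rw [e2, mul_add, sum_add_distrib]
  rw [e3]
  congr 1
  simp_rw [chr_eq h.contDiffAt_two, sum_mul (s := (univ : Finset (Fin m))),
    mul_sum (s := (univ : Finset (Fin m)))]
  rw [sum_comm]
  refine sum_congr rfl fun c _ => ?_
  rw [sum_comm]
  exact sum_congr rfl fun d _ => sum_congr rfl fun b _ => by ring

theorem lapBel_eq {u : (Fin m → ℝ) → ℝ} (hu : ContDiffAt ℝ 2 u (φ y)) :
    lapBel (f ∘ φ) (fun z => u (φ z)) y = lapBel f u (φ y) := by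
  have hu' := hu.differentiableAt (by simp)
  have e : ∀ i j, pd (fun z => pd (fun w => u (φ w)) i z) j y
      - ∑ k, chr (f ∘ φ) k i j y * pd (fun z => u (φ z)) k y =
      ∑ a, ∑ b, (pd (fun z => pd u a z) b (φ y) - ∑ k, chr f k a b (φ y) * pd u k (φ y))
        * jac φ a i y * jac φ b j y := by
    intro i j
    have e1 : pd (fun z => pd (fun w => u (φ w)) i z) j y =
        ∑ a, ∑ b, pd (pd u a) b (φ y) * jac φ a i y * jac φ b j y
          + ∑ a, pd u a (φ y) * pd (jac φ a j) i y := by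
      have := pd_pd_comp hu h.contDiffAt_coord j i
      rw [sum_comm] at this
      refine this.trans (congrArg₂ _ ?_ ?_)
      · exact sum_congr rfl fun a _ => sum_congr rfl fun b _ => by ring
      · exact sum_congr rfl fun a _ => by rw [pd_jac_symm h.contDiffAt_coord]
    have e2 : ∑ k, chr (f ∘ φ) k i j y * pd (fun z => u (φ z)) k y =
        ∑ a, pd u a (φ y) * ∑ k, jac φ a k y * chr (f ∘ φ) k i j y := by
      simp_rw [fun k => pd_comp hu' h.differentiableAt_coord k, mul_sum]
      rw [sum_comm]
      exact sum_congr rfl fun a _ => sum_congr rfl fun k _ => by rw [jac]; ring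
    rw [e1, e2]
    simp_rw [h.sum_jac_mul_chr, mul_add, sum_add_distrib, sub_mul, sum_sub_distrib]
    rw [add_sub_add_right_eq_sub]
    congr 1
    simp_rw [mul_sum, sum_mul]
    rw [sum_comm]
    refine sum_congr rfl fun c _ => ?_
    rw [sum_comm]
    exact sum_congr rfl fun d _ => sum_congr rfl fun b _ => by ring
  simp_rw [lapBel, e, sum_contract_two (J := fun a i => jac φ a i y) h.sum_gInv]

end IsReparamAt

end ReparametrizationInvariance

section DerivativeInvariance

variable {m n : ℕ} {f : (Fin m → ℝ) → (Fin n → ℝ)} {φ : (Fin m → ℝ) → (Fin m → ℝ)}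
  {y : Fin m → ℝ}

theorem sum_comm_three {ι κ : Type*} [Fintype ι] [Fintype κ] (u : κ → κ → κ → ι → ℝ) :
    ∑ γ, ∑ δ, ∑ ε, ∑ a, u γ δ ε a = ∑ a, ∑ γ, ∑ δ, ∑ ε, u γ δ ε a :=
  calc _ = ∑ γ, ∑ δ, ∑ a, ∑ ε, u γ δ ε a :=
        sum_congr rfl fun _ _ => sum_congr rfl fun _ _ => sum_comm
    _ = ∑ γ, ∑ a, ∑ δ, ∑ ε, u γ δ ε a := sum_congr rfl fun _ _ => sum_comm
    _ = _ := sum_comm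

theorem contDiffAt_norP (hf : ContDiffAt ℝ ∞ f y) (hdet : (gMat f y).det ≠ 0) (α β : Fin n) :
    ContDiffAt ℝ ∞ (norP f α β) y :=
  contDiffAt_const.sub <| ContDiffAt.sum fun i _ => ContDiffAt.sum fun j _ =>
    ((contDiffAt_gInv hf hdet i j).mul (hf.Fd (by simp) α i)).mul (hf.Fd (by simp) β j)

variable (hf : ContDiffAt ℝ ∞ f (φ y)) (hφ : ContDiffAt ℝ ∞ φ y)
  (hdet : (gMat (f ∘ φ) y).det ≠ 0)
include hf hφ hdet

theorem dnorP_comp (i : Fin m) (α β : Fin n) :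
    dnorP (f ∘ φ) i α β y = ∑ a, dnorP f a α β (φ y) * jac φ a i y := by
  have h := eventually_isReparamAt hf hφ hdet
  have h1 : (fun z => norP (f ∘ φ) α β z) =ᶠ[𝓝 y] fun z => norP f α β (φ z) :=
    h.mono fun z hz => hz.norP_eq α β
  rw [dnorP, pd_congr h1]
  exact pd_comp (contDiffAt_norP hf h.self_of_nhds.det_ne_zero' α β).diff_of_infty
    hφ.diff_of_infty i

theorem normCurv_comp (α β : Fin n) (i j : Fin m) : normCurv (f ∘ φ) α β i j y =
    ∑ a, ∑ b, normCurv f α β a b (φ y) * jac φ a i y * jac φ b j y := by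
  have h := (eventually_isReparamAt hf hφ hdet).self_of_nhds
  have e : ∀ γ δ ε, norP (f ∘ φ) α γ y * (dnorP (f ∘ φ) i γ δ y * dnorP (f ∘ φ) j δ ε y
      - dnorP (f ∘ φ) j γ δ y * dnorP (f ∘ φ) i δ ε y) * norP (f ∘ φ) ε β y =
      ∑ a, ∑ b, norP f α γ (φ y) * (dnorP f a γ δ (φ y) * dnorP f b δ ε (φ y)
        - dnorP f b γ δ (φ y) * dnorP f a δ ε (φ y)) * norP f ε β (φ y)
        * jac φ a i y * jac φ b j y := by
    intro γ δ ε
    simp_rw [h.norP_eq, dnorP_comp hf hφ hdet]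
    rw [mul_comm (∑ a, dnorP f a γ δ (φ y) * jac φ a j y)]
    simp_rw [sum_mul_sum, ← sum_sub_distrib, mul_sum, sum_mul]
    exact sum_congr rfl fun a _ => sum_congr rfl fun b _ => by ring
  simp_rw [normCurv, e]
  rw [sum_comm_three]
  refine sum_congr rfl fun a _ => ?_
  rw [sum_comm_three]
  simp_rw [sum_mul]

theorem normRperp2_comp : normRperp2 (f ∘ φ) y = normRperp2 f (φ y) := by
  have h := (eventually_isReparamAt hf hφ hdet).self_of_nhds
  simp_rw [normRperp2, normCurv_comp hf hφ hdet,
    sum_contract_four (J := fun a i => jac φ a i y) h.sum_gInv]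

theorem pd_sff_comp (l : Fin m) (α : Fin n) (i j : Fin m) :
    pd (fun z => sff (f ∘ φ) α i j z) l y =
      ∑ a, ∑ b, ((∑ c, pd (sff f α a b) c (φ y) * jac φ c l y) * jac φ a i y * jac φ b j y
        + sff f α a b (φ y) * pd (jac φ a i) l y * jac φ b j y
        + sff f α a b (φ y) * jac φ a i y * pd (jac φ b j) l y) := by
  have h := eventually_isReparamAt hf hφ hdet
  have h1 : (fun z => sff (f ∘ φ) α i j z) =ᶠ[𝓝 y]
      fun z => ∑ a, ∑ b, sff f α a b (φ z) * jac φ a i z * jac φ b j z :=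
    h.mono fun z hz => hz.sff_eq α i j
  have hs : ∀ a b, DifferentiableAt ℝ (sff f α a b) (φ y) := fun a b =>
    (contDiffAt_sff hf h.self_of_nhds.det_ne_zero' α a b).diff_of_infty
  have hφ' := hφ.diff_of_infty
  have hc : ∀ a b, DifferentiableAt ℝ (fun z => sff f α a b (φ z)) y := fun a b =>
    DifferentiableAt.comp y (hs a b) hφ'
  have hj : ∀ a i, DifferentiableAt ℝ (jac φ a i) y := fun a i =>
    (hφ.jac (k := ∞) (by simp) a i).diff_of_infty
  have h3 := fun a b => (hc a b).fun_mul (hj a i)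
  have h4 := fun a b => (h3 a b).fun_mul (hj b j)
  rw [pd_congr h1, pd_sum fun a _ => DifferentiableAt.fun_sum fun b _ => h4 a b]
  refine sum_congr rfl fun a _ => ?_
  rw [pd_sum fun b _ => h4 a b]
  refine sum_congr rfl fun b _ => ?_
  rw [pd_mul (h3 a b) (hj b j), pd_mul (hc a b) (hj a i), pd_comp (hs a b) hφ']
  simp only [jac]
  ring

theorem covA_comp (l : Fin m) (α : Fin n) (i j : Fin m) : covA (f ∘ φ) l α i j y =
    ∑ c, ∑ a, ∑ b, covA f c α a b (φ y) * jac φ c l y * jac φ a i y * jac φ b j y := by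
  have h := (eventually_isReparamAt hf hφ hdet).self_of_nhds
  have e1 : ∑ k, chr (f ∘ φ) k l i y * sff (f ∘ φ) α k j y =
      ∑ a, ∑ b, sff f α a b (φ y) * jac φ b j y * ∑ k, jac φ a k y * chr (f ∘ φ) k l i y := by
    simp_rw [h.sff_eq, mul_sum]
    rw [sum_comm]
    refine sum_congr rfl fun a _ => ?_
    rw [sum_comm]
    exact sum_congr rfl fun b _ => sum_congr rfl fun k _ => by ring
  have e2 : ∑ k, chr (f ∘ φ) k l j y * sff (f ∘ φ) α i k y =
      ∑ a, ∑ b, sff f α a b (φ y) * jac φ a i y * ∑ k, jac φ b k y * chr (f ∘ φ) k l j y := by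
    simp_rw [h.sff_eq, mul_sum]
    rw [sum_comm]
    refine sum_congr rfl fun a _ => ?_
    rw [sum_comm]
    exact sum_congr rfl fun b _ => sum_congr rfl fun k _ => by ring
  have e3 : ∑ a, ∑ b, sff f α a b (φ y) * jac φ b j y
        * ∑ c, ∑ d, chr f a c d (φ y) * jac φ c l y * jac φ d i y =
      ∑ c, ∑ a, ∑ b, (∑ k, chr f k c a (φ y) * sff f α k b (φ y))
        * jac φ c l y * jac φ a i y * jac φ b j y := by
    simp_rw [mul_sum, sum_mul]
    rw [sum_sum_comm_sum_sum]
    refine sum_congr rfl fun c _ => sum_congr rfl fun a _ => ?_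
    rw [sum_comm]
    exact sum_congr rfl fun b _ => sum_congr rfl fun k _ => by ring
  have e4 : ∑ a, ∑ b, sff f α a b (φ y) * jac φ a i y
        * ∑ c, ∑ d, chr f b c d (φ y) * jac φ c l y * jac φ d j y =
      ∑ c, ∑ a, ∑ b, (∑ k, chr f k c b (φ y) * sff f α a k (φ y))
        * jac φ c l y * jac φ a i y * jac φ b j y := by
    simp_rw [mul_sum, sum_mul]
    rw [sum_sum_comm_sum_sum]
    refine sum_congr rfl fun c _ => ?_
    rw [sum_comm]
    exact sum_congr rfl fun a _ => sum_congr rfl fun b _ => sum_congr rfl fun k _ => by ring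
  have e5 : ∑ a, ∑ b, (∑ c, pd (sff f α a b) c (φ y) * jac φ c l y) * jac φ a i y * jac φ b j y =
      ∑ c, ∑ a, ∑ b, pd (sff f α a b) c (φ y) * jac φ c l y * jac φ a i y * jac φ b j y := by
    simp_rw [sum_mul]
    rw [sum_comm (f := fun c a => ∑ b, pd (sff f α a b) c (φ y) * jac φ c l y * jac φ a i y
      * jac φ b j y)]
    exact sum_congr rfl fun a _ => sum_comm
  rw [covA, pd_sff_comp hf hφ hdet, e1, e2]
  simp_rw [h.sum_jac_mul_chr, covA, mul_add, sub_mul, sum_add_distrib, sum_sub_distrib]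
  rw [e3, e4, e5]
  have e6 : ∑ a, ∑ b, sff f α a b (φ y) * pd (jac φ a i) l y * jac φ b j y =
      ∑ a, ∑ b, sff f α a b (φ y) * jac φ b j y * pd (jac φ a i) l y :=
    sum_congr rfl fun a _ => sum_congr rfl fun b _ => by ring
  rw [e6]
  ring

theorem nperpA_comp (l : Fin m) (α : Fin n) (i j : Fin m) : nperpA (f ∘ φ) l α i j y =
    ∑ c, ∑ a, ∑ b, nperpA f c α a b (φ y) * jac φ c l y * jac φ a i y * jac φ b j y := by
  have h := (eventually_isReparamAt hf hφ hdet).self_of_nhds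
  have e1 : ∀ β, ∑ k, ∑ p, gInv (f ∘ φ) k p y * Fd (f ∘ φ) α k y * sff (f ∘ φ) β p l y =
      ∑ c, (∑ k, ∑ p, gInv f k p (φ y) * Fd f α k (φ y) * sff f β p c (φ y)) * jac φ c l y := by
    intro β
    have e : ∀ p, sff (f ∘ φ) β p l y =
        ∑ q, (∑ c, sff f β q c (φ y) * jac φ c l y) * jac φ q p y := by
      intro p
      rw [h.sff_eq]
      refine sum_congr rfl fun q _ => ?_
      rw [sum_mul]
      exact sum_congr rfl fun c _ => by ring
    simp_rw [h.Fd_eq, e, sum_contract_mul (J := fun a i => jac φ a i y) h.sum_gInv, mul_sum,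
      sum_mul]
    symm
    rw [sum_comm]
    refine sum_congr rfl fun k _ => ?_
    rw [sum_comm]
    exact sum_congr rfl fun p _ => sum_congr rfl fun c _ => by ring
  have e2 : ∀ (g : (Fin m → ℝ) → (Fin n → ℝ)) z l i j,
      ∑ β, ∑ k, ∑ p, sff g β i j z * gInv g k p z * sff g β p l z * Fd g α k z =
      ∑ β, sff g β i j z * ∑ k, ∑ p, gInv g k p z * Fd g α k z * sff g β p l z := by
    intro g z l i j
    simp_rw [mul_sum]
    exact sum_congr rfl fun β _ => sum_congr rfl fun k _ => sum_congr rfl fun p _ => by ring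
  simp_rw [nperpA, covA_comp hf hφ hdet, e2, e1, h.sff_eq, add_mul, sum_add_distrib]
  congr 1
  simp_rw [sum_mul (s := (univ : Finset (Fin n)))]
  rw [sum_comm_three]
  refine sum_congr rfl fun β _ => ?_
  rw [mul_comm, sum_mul]
  refine sum_congr rfl fun c _ => ?_
  rw [mul_sum]
  refine sum_congr rfl fun a _ => ?_
  rw [mul_sum]
  exact sum_congr rfl fun b _ => by ring

theorem normNperpA2_comp : normNperpA2 (f ∘ φ) y = normNperpA2 f (φ y) := by
  have h := (eventually_isReparamAt hf hφ hdet).self_of_nhds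
  have key : ∀ (g : (Fin m → ℝ) → (Fin n → ℝ)) z, normNperpA2 g z =
      ∑ α, ∑ l, ∑ l', gInv g l l' z * ∑ i, ∑ j, ∑ i', ∑ j', gInv g i i' z * gInv g j j' z
        * nperpA g l α i j z * nperpA g l' α i' j' z := by
    intro g z
    refine sum_congr rfl fun α _ => sum_congr rfl fun l _ => sum_congr rfl fun l' _ => ?_
    rw [mul_sum]
    refine sum_congr rfl fun i _ => ?_
    rw [sum_comm, mul_sum]
    refine sum_congr rfl fun j _ => ?_
    rw [mul_sum]
    refine sum_congr rfl fun i' _ => ?_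
    rw [mul_sum]
    exact sum_congr rfl fun j' _ => by ring
  rw [key, key]
  refine sum_congr rfl fun α _ => ?_
  rw [← sum_contract_two (J := fun a i => jac φ a i y) h.sum_gInv]
  refine sum_congr rfl fun l _ => sum_congr rfl fun l' _ => ?_
  congr 1
  have e : ∀ l i j, nperpA (f ∘ φ) l α i j y = ∑ a, ∑ b,
      (∑ c, nperpA f c α a b (φ y) * jac φ c l y) * jac φ a i y * jac φ b j y := by
    intro l i j
    rw [nperpA_comp hf hφ hdet, sum_comm]
    refine sum_congr rfl fun a _ => ?_
    rw [sum_comm]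
    simp_rw [sum_mul]
  simp_rw [e]
  rw [sum_contract_four (J := fun a i => jac φ a i y) h.sum_gInv
    (fun a b => ∑ c, nperpA f c α a b (φ y) * jac φ c l y)
    (fun a b => ∑ c, nperpA f c α a b (φ y) * jac φ c l' y)]
  have e₁ : ∀ i j i' j', gInv f i i' (φ y) * gInv f j j' (φ y)
      * (∑ c, nperpA f c α i j (φ y) * jac φ c l y)
      * (∑ c, nperpA f c α i' j' (φ y) * jac φ c l' y) =
      ∑ c, ∑ c', gInv f i i' (φ y) * gInv f j j' (φ y) * nperpA f c α i j (φ y)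
        * nperpA f c' α i' j' (φ y) * jac φ c l y * jac φ c' l' y := by
    intro i j i' j'
    rw [mul_assoc, sum_mul_sum, mul_sum]
    refine sum_congr rfl fun c _ => ?_
    rw [mul_sum]
    exact sum_congr rfl fun c' _ => by ring
  have e₂ : ∀ i j i', (∑ j', ∑ c, ∑ c', gInv f i i' (φ y) * gInv f j j' (φ y)
      * nperpA f c α i j (φ y) * nperpA f c' α i' j' (φ y) * jac φ c l y * jac φ c' l' y) =
      ∑ c, ∑ j', ∑ c', gInv f i i' (φ y) * gInv f j j' (φ y) * nperpA f c α i j (φ y)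
        * nperpA f c' α i' j' (φ y) * jac φ c l y * jac φ c' l' y := fun _ _ _ => sum_comm
  simp_rw [e₁, e₂]
  rw [sum_comm_three]
  refine sum_congr rfl fun c _ => ?_
  have e₃ : ∀ i j i', (∑ j', ∑ c', gInv f i i' (φ y) * gInv f j j' (φ y) * nperpA f c α i j (φ y)
        * nperpA f c' α i' j' (φ y) * jac φ c l y * jac φ c' l' y) =
      ∑ c', ∑ j', gInv f i i' (φ y) * gInv f j j' (φ y) * nperpA f c α i j (φ y)
        * nperpA f c' α i' j' (φ y) * jac φ c l y * jac φ c' l' y := fun _ _ _ => sum_comm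
  simp_rw [e₃]
  rw [sum_comm_three]
  simp_rw [sum_mul]

end DerivativeInvariance

section GraphCoordinates

variable {m n : ℕ} {f : (Fin m → ℝ) → (Fin n → ℝ)} {x : Fin m → ℝ}

theorem jac_of_comp_eq_id {ψ φ : (Fin m → ℝ) → (Fin m → ℝ)} {y : Fin m → ℝ}
    (hψ : DifferentiableAt ℝ ψ (φ y)) (hφ : DifferentiableAt ℝ φ y)
    (h : ∀ᶠ z in 𝓝 y, ψ (φ z) = z) :
    (Matrix.of fun i a => jac ψ i a (φ y)) * (Matrix.of fun a i => jac φ a i y) = 1 := by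
  ext i j
  have hc : pd (fun z => ψ (φ z) i) j y = pd (fun z => z i) j y :=
    pd_congr (h.mono fun z hz => by simp only [hz]) j
  rw [pd_comp (f := fun z => ψ z i) (differentiableAt_pi.1 hψ i) hφ, pd_coord] at hc
  simpa only [Matrix.mul_apply, Matrix.of_apply, Matrix.one_apply, jac] using hc

open scoped MatrixOrder Matrix.Norms.L2Operator in
theorem exists_gMat_eq_transpose_mul_self (f : (Fin m → ℝ) → (Fin n → ℝ)) (x : Fin m → ℝ) :
    ∃ B : Matrix (Fin m) (Fin m) ℝ, gMat f x = B.transpose * B := by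
  have h : gMat f x = (Matrix.of fun α i => Fd f α i x).conjTranspose *
      Matrix.of fun α i => Fd f α i x := by
    ext i j
    simp [gMat, gInd, Matrix.mul_apply]
  have hp : (gMat f x).PosSemidef := by
    rw [h]
    exact Matrix.posSemidef_conjTranspose_mul_self _
  obtain ⟨B, hB⟩ := CStarAlgebra.nonneg_iff_eq_star_mul_self.mp hp.nonneg
  exact ⟨B, by
    simpa [Matrix.star_eq_conjTranspose, Matrix.conjTranspose_eq_transpose_of_trivial] using hB⟩

theorem exists_contDiffAt_rightInverse {ψ : (Fin m → ℝ) → (Fin m → ℝ)}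
    (hψ : ContDiffAt ℝ ∞ ψ x) (hdet : IsUnit (Matrix.of fun i a => jac ψ i a x).det) :
    ∃ φ : (Fin m → ℝ) → (Fin m → ℝ), φ (ψ x) = x ∧ ContDiffAt ℝ ∞ φ (ψ x) ∧
      ∀ᶠ y in 𝓝 (ψ x), ψ (φ y) = y := by
  set J : Matrix (Fin m) (Fin m) ℝ := Matrix.of fun i a => jac ψ i a x with hJ
  let e : (Fin m → ℝ) ≃L[ℝ] (Fin m → ℝ) :=
    (Matrix.toLin'OfInv (Matrix.nonsing_inv_mul J hdet)
      (Matrix.mul_nonsing_inv J hdet)).toContinuousLinearEquiv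
  have hd := hψ.diff_of_infty
  have he : HasFDerivAt ψ (e : (Fin m → ℝ) →L[ℝ] (Fin m → ℝ)) x := by
    suffices heq : (e : (Fin m → ℝ) →L[ℝ] (Fin m → ℝ)) = fderiv ℝ ψ x by
      rw [heq]
      exact hd.hasFDerivAt
    apply ContinuousLinearMap.coe_injective
    refine LinearMap.pi_ext' fun a => LinearMap.ext_ring ?_
    ext i
    have : fderiv ℝ ψ x (Pi.single a 1) i = J i a := by
      rw [hJ, Matrix.of_apply, jac, pd, (hasFDerivAt_pi'.1 hd.hasFDerivAt i).fderiv]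
      rfl
    simpa [e] using this.symm
  have hn : (∞ : WithTop ℕ∞) ≠ 0 := by simp
  refine ⟨hψ.localInverse he hn, hψ.localInverse_apply_image he hn, hψ.to_localInverse he hn, ?_⟩
  exact (hψ.hasStrictFDerivAt' he hn).eventually_right_inverse

theorem exists_isGraphAt_comp (hf : ContDiffAt ℝ ∞ f x) (hdet : (gMat f x).det ≠ 0) :
    ∃ (φ : (Fin m → ℝ) → (Fin m → ℝ)) (y : Fin m → ℝ),
      φ y = x ∧ ContDiffAt ℝ ∞ φ y ∧ IsGraphAt (f ∘ φ) y := by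
  obtain ⟨B, hB⟩ := exists_gMat_eq_transpose_mul_self f x
  have hBdet : IsUnit B.det := by
    rw [hB, Matrix.det_mul, Matrix.det_transpose] at hdet
    exact (left_ne_zero_of_mul hdet).isUnit
  let u : Fin n → Fin m → ℝ := fun α i => ∑ a, Fd f α a x * B⁻¹ a i
  let ψ : (Fin m → ℝ) → (Fin m → ℝ) := fun z i => ∑ α, u α i * f z α
  have hfα := contDiffAt_pi.1 hf
  have hψ : ContDiffAt ℝ ∞ ψ x := by
    refine contDiffAt_pi.2 fun i => ContDiffAt.sum fun α _ => contDiffAt_const.mul (hfα α)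
  have hJ : (Matrix.of fun i a => jac ψ i a x) = B := by
    have hL : (B⁻¹).transpose * gMat f x = B := by
      rw [hB, ← Matrix.mul_assoc, ← Matrix.transpose_mul, Matrix.mul_nonsing_inv B hBdet,
        Matrix.transpose_one, Matrix.one_mul]
    rw [← hL]
    ext i a
    have hd : ∀ α, DifferentiableAt ℝ (fun z => f z α) x := fun α => (hfα α).diff_of_infty
    simp only [Matrix.of_apply, jac, ψ, Matrix.mul_apply, Matrix.transpose_apply, gMat, gInd]
    rw [pd_sum fun α _ => (hd α).const_mul _]
    simp_rw [pd_const_mul _ (hd _), u, sum_mul, mul_sum]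
    rw [sum_comm]
    exact sum_congr rfl fun b _ => sum_congr rfl fun α _ => by rw [Fd, Fd]; ring
  obtain ⟨φ, hφx, hφ, hright⟩ := exists_contDiffAt_rightInverse hψ (by rw [hJ]; exact hBdet)
  have hjac := jac_of_comp_eq_id (ψ := ψ) (φ := φ) (y := ψ x) (by rw [hφx]; exact hψ.diff_of_infty)
    hφ.diff_of_infty hright
  rw [hφx, hJ] at hjac
  have hinv := Matrix.inv_eq_right_inv hjac
  refine ⟨φ, ψ x, hφx, hφ, ContDiffAt.comp _ (by rwa [hφx]) hφ, ?_⟩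
  filter_upwards [hright] with y hy i
  conv_rhs => rw [← hy]
  refine sum_congr rfl fun α _ => ?_
  rw [Fd_comp (by rw [hφx]; exact hf.diff_of_infty) hφ.diff_of_infty, hφx]
  simp only [u, hinv, Matrix.of_apply, Function.comp_apply]

end GraphCoordinates

section Invariance

variable {m n : ℕ} {f : (Fin m → ℝ) → (Fin n → ℝ)} {x : Fin m → ℝ}

theorem lapBel_congr {u v : (Fin m → ℝ) → ℝ} (h : u =ᶠ[𝓝 x] v) : lapBel f u x = lapBel f v x := by
  simp only [lapBel, pd_congr h, fun i j => pd_congr (h.pd i) j]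

theorem contDiffAt_normA2 (hf : ContDiffAt ℝ ∞ f x) (hdet : (gMat f x).det ≠ 0) :
    ContDiffAt ℝ ∞ (normA2 f) x :=
  ContDiffAt.sum fun _ _ => ContDiffAt.sum fun _ _ => ContDiffAt.sum fun _ _ =>
    ContDiffAt.sum fun _ _ => ContDiffAt.sum fun _ _ =>
      (((contDiffAt_gInv hf hdet _ _).mul (contDiffAt_gInv hf hdet _ _)).mul
        (contDiffAt_sff hf hdet _ _ _)).mul (contDiffAt_sff hf hdet _ _ _)

theorem lapBel_normA2_comp {φ : (Fin m → ℝ) → (Fin m → ℝ)} {y : Fin m → ℝ}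
    (hf : ContDiffAt ℝ ∞ f (φ y)) (hφ : ContDiffAt ℝ ∞ φ y) (hdet : (gMat (f ∘ φ) y).det ≠ 0) :
    lapBel (f ∘ φ) (normA2 (f ∘ φ)) y = lapBel f (normA2 f) (φ y) := by
  have he := eventually_isReparamAt hf hφ hdet
  rw [lapBel_congr (he.mono fun z hz => hz.normA2_eq)]
  refine he.self_of_nhds.lapBel_eq ?_
  exact ((contDiffAt_normA2 hf he.self_of_nhds.det_ne_zero').eventually_of_infty 2).self_of_nhds

end Invariance

/-- Under mean curvature flow,
`d/dt |A|² = Δ|A|² - 2|∇^⊥A|² + 2|A^{αm}_n A^{βn}_m|² + 2|R^⊥|²`. -/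
theorem secondFundamentalForm_evolution {m n : ℕ} (F : ℝ → (Fin m → ℝ) → (Fin n → ℝ)) (T : ℝ)
    (hT : 0 < T)
    (hF : ContDiff ℝ (⊤ : ℕ∞) (fun p : ℝ × (Fin m → ℝ) => F p.1 p.2))
    (himm : ∀ t ∈ Set.Ico (0 : ℝ) T, ∀ x, (gMat (F t) x).det ≠ 0)
    (hMCF : ∀ t ∈ Set.Ico (0 : ℝ) T, ∀ x α, deriv (fun s => F s x α) t = mcv (F t) α x) :
    ∀ t ∈ Set.Ico (0 : ℝ) T, ∀ x,
      deriv (fun s => normA2 (F s) x) t =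
        lapBel (F t) (normA2 (F t)) x - 2 * normNperpA2 (F t) x
          + 2 * normSsf2 (F t) x + 2 * normRperp2 (F t) x := by
  intro t ht x
  have hFs : ∀ s z, ContDiffAt ℝ ∞ (F s) z := fun s z =>
    ContDiffAt.comp z (g := fun p : ℝ × (Fin m → ℝ) => F p.1 p.2) (f := fun y => (s, y))
      hF.contDiffAt (contDiffAt_const.prodMk contDiffAt_id)
  obtain ⟨φ, y, rfl, hφ, hgraph⟩ := exists_isGraphAt_comp (hFs t x) (himm t ht x)
  have hdet : (gMat (F t ∘ φ) y).det ≠ 0 := hgraph.det_ne_zero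
  have hreg := eventually_isReparamAt (hFs t (φ y)) hφ hdet
  have hX : ContDiffAt ℝ ∞ (fun p : ℝ × (Fin m → ℝ) => (F p.1 ∘ φ) p.2) (t, y) :=
    ContDiffAt.comp (t, y) (g := fun p : ℝ × (Fin m → ℝ) => F p.1 p.2)
      (f := fun p : ℝ × (Fin m → ℝ) => (p.1, φ p.2)) hF.contDiffAt
      (contDiffAt_fst.prodMk (ContDiffAt.comp (t, y) hφ contDiffAt_snd))
  have hflow : ∀ᶠ z in 𝓝 y, ∀ α,
      deriv (fun s => (F s ∘ φ) z α) t = mcv (F t ∘ φ) α z :=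
    hreg.mono fun z hz α => (hMCF t ht (φ z) α).trans (hz.mcv_eq α).symm
  have htime : (fun s => normA2 (F s ∘ φ) y) =ᶠ[𝓝 t] fun s => normA2 (F s) (φ y) :=
    (eventually_det_ne_zero_time (X := fun s => F s ∘ φ) hX hdet).mono fun s hs =>
      (eventually_isReparamAt (hFs s (φ y)) hφ hs).self_of_nhds.normA2_eq
  have key := IsGraphAt.deriv_normA2 (X := fun s => F s ∘ φ) hgraph hX hflow
  rwa [htime.deriv_eq, lapBel_normA2_comp (hFs t _) hφ hdet, normNperpA2_comp (hFs t _) hφ hdet,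
    hreg.self_of_nhds.normSsf2_eq, normRperp2_comp (hFs t _) hφ hdet] at key

end
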